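/- arXiv:2208.02535 — 2 statements merged into one kernel-verified Lean document; each statement's English description precedes it below -/
import Mathlib

section
/- Let p be a prime number and (A,+,∘) a left brace of cardinality p^n with p > n+1. Then for every a ∈ A, the (p^p)!-fold iterate of f satisfies [f^{(p^p!)}(a)] = [a] in A/ann(p^2), where f^{(1)}(a) = f(a) and f^{(i+1)}(a) = f(f^{(i)}(a)). -/
universe u

/-- A left brace: `(A,+)` abelian group, `(A,∘)` a group, with
`a∘(b+c)+a = a∘b+a∘c`. -/
structure LeftBrace (A : Type u) [AddCommGroup A] where
  circ : A → A → A
  one : A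
  inv : A → A
  circ_assoc : ∀ a b c : A, circ (circ a b) c = circ a (circ b c)
  one_circ : ∀ a : A, circ one a = a
  circ_one : ∀ a : A, circ a one = a
  inv_circ : ∀ a : A, circ (inv a) a = one
  circ_add : ∀ a b c : A, circ a (b + c) + a = circ a b + circ a c

/-- `a*b = a∘b - a - b`. -/
def LeftBrace.star {A : Type u} [AddCommGroup A] (B : LeftBrace A) (a b : A) : A :=
  B.circ a b - a - b

/-- `ann(k) = {a : k•a = 0}`, as an additive subgroup. -/
def annSub (A : Type u) [AddCommGroup A] (k : ℕ) : AddSubgroup A where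
  carrier := {a : A | k • a = 0}
  zero_mem' := by simp
  add_mem' := by
    intro a b ha hb
    have ha' : k • a = 0 := ha
    have hb' : k • b = 0 := hb
    show k • (a + b) = 0
    rw [smul_add, ha', hb', add_zero]
  neg_mem' := by
    intro a ha
    have ha' : k • a = 0 := ha
    show k • (-a) = 0
    rw [smul_neg, ha', neg_zero]

/-- The coset `[a]` of `a` in `A/ann(k)`. -/
def qmk {A : Type u} [AddCommGroup A] (k : ℕ) (a : A) : A ⧸ annSub A k :=
  QuotientAddGroup.mk a

/-- Evaluation of a non-associative word under a binary operation `op`,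
substituting `f i` for the variable `i`. -/
def wEval {α : Type*} {β : Type*} (op : β → β → β) (f : α → β) : FreeMagma α → β
  | FreeMagma.of a => f a
  | FreeMagma.mul x y => op (wEval op f x) (wEval op f y)

/-- The list of leaves (occurrences of variables, left to right) of a word. -/
def wLeaves {α : Type*} : FreeMagma α → List α
  | FreeMagma.of a => [a]
  | FreeMagma.mul x y => wLeaves x ++ wLeaves y

/-- The last (rightmost) variable of a word. -/
def wLast {α : Type*} : FreeMagma α → α
  | FreeMagma.of a => a
  | FreeMagma.mul _ y => wLast y

/-- The number of occurrences of the variable `a` in a word. -/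
def wCount {α : Type*} [DecidableEq α] (a : α) : FreeMagma α → ℕ
  | FreeMagma.of b => if b = a then 1 else 0
  | FreeMagma.mul x y => wCount a x + wCount a y

/-- The length (number of variable occurrences) of a word. -/
def wLen {α : Type*} : FreeMagma α → ℕ
  | FreeMagma.of _ => 1
  | FreeMagma.mul x y => wLen x + wLen y

/-- Left-normed product `a₁·(a₂·(⋯(aₘ·b)⋯))`. -/
def leftProd {Q : Type*} (mul : Q → Q → Q) : List Q → Q → Q
  | [], b => b
  | a :: l, b => mul a (leftProd mul l b)

/-- `circPow B a k` is the product of `k` copies of `a` under `∘`. -/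
def circPow {A : Type u} [AddCommGroup A] (B : LeftBrace A) (a : A) : ℕ → A
  | 0 => B.one
  | k + 1 => B.circ a (circPow B a k)

/-- `eSeq B a (i-1)` is `a_i`, where `a_1 = a` and `a_{i+1} = a * a_i`. -/
def eSeq {A : Type u} [AddCommGroup A] (B : LeftBrace A) (a : A) : ℕ → A
  | 0 => a
  | i + 1 => B.star a (eSeq B a i)

/-- `starIter B a b (i-1)` is `e_i`, where `e_1 = a*b` and `e_{i+1} = a*e_i`. -/
def starIter {A : Type u} [AddCommGroup A] (B : LeftBrace A) (a b : A) : ℕ → A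
  | 0 => B.star a b
  | i + 1 => B.star a (starIter B a b i)

/-- `iterOp op u v i` is `u ⊙ (u ⊙ (⋯ (u ⊙ v)))` with `i` applications of `u ⊙ ·`. -/
def iterOp {Q : Type*} (op : Q → Q → Q) (u v : Q) : ℕ → Q
  | 0 => v
  | i + 1 => op u (iterOp op u v i)

/-- `f(a) = Σ_{i=1}^{p−1} (C(p−1,i−1)/i)·e_i` where `e_1 = a`, `e_{i+1} = a*e_i`. -/
def fMap {A : Type u} [AddCommGroup A] (B : LeftBrace A) (p : ℕ) (a : A) : A :=
  ∑ i ∈ Finset.Icc 1 (p - 1), (Nat.choose (p - 1) (i - 1) / i) • eSeq B a (i - 1)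

/-- `braceChainAux B (i-1)` is `A^i`: `A^1 = A`, `A^{i+1}` the additive subgroup
generated by `{x*y : x ∈ A, y ∈ A^i}`. -/
def braceChainAux {A : Type u} [AddCommGroup A] (B : LeftBrace A) : ℕ → AddSubgroup A
  | 0 => ⊤
  | i + 1 => AddSubgroup.closure {z : A | ∃ x : A, ∃ y ∈ braceChainAux B i, z = B.star x y}

/-- `dSeq B a b i = (d_i, d_i')`: `d_0 = a`, `d_0' = b`, `d_{i+1} = d_i + d_i'`,
`d_{i+1}' = d_i * d_i'`. -/
def dSeq {A : Type u} [AddCommGroup A] (B : LeftBrace A) (a b : A) : ℕ → A × A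
  | 0 => (a, b)
  | i + 1 => ((dSeq B a b i).1 + (dSeq B a b i).2, B.star (dSeq B a b i).1 (dSeq B a b i).2)


section Helpers

open Polynomial

theorem aux_smul_pow {R : Type*} [Ring R] (N : ℕ) (s t : R) (h : N • s = N • t) (i : ℕ) :
    N • s ^ i = N • t ^ i := by
  induction i with
  | zero => simp
  | succ i ih =>
    rw [pow_succ, pow_succ, ← smul_mul_assoc, ih, smul_mul_assoc, ← mul_smul_comm, h,
      mul_smul_comm]

theorem aux_aeval {R : Type*} [Ring R] (N : ℕ) (u v : R) (j : ℕ)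
    (h : ∀ i, j ≤ i → N • u ^ i = N • v ^ i) (r : ℤ[X]) :
    N • aeval u (X ^ j * r) = N • aeval v (X ^ j * r) := by
  induction r using Polynomial.induction_on' with
  | add p q hp hq => rw [mul_add, map_add, map_add, smul_add, smul_add, hp, hq]
  | monomial n c =>
    have key : ∀ w : R, N • aeval w (X ^ j * monomial n c : ℤ[X]) = c • (N • w ^ (j + n)) := by
      intro w
      rw [← C_mul_X_pow_eq_monomial, map_mul, map_mul, map_pow, map_pow, aeval_X, aeval_C,
        smul_comm c N]
      congr 1
      rw [eq_intCast, pow_add, ← (Int.cast_commute c (w ^ j)).left_comm, zsmul_eq_mul]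
    rw [key, key, h _ (by omega)]

theorem aux_inv {R : Type*} [Ring R] (N K : ℕ) (u v : R) (hu : u ^ K = 0) (hv : v ^ K = 0)
    (q : ℤ[X]) (h : N • aeval u (X * (1 + X * q)) = N • aeval v (X * (1 + X * q))) :
    N • u = N • v := by
  have main : ∀ m j, K ≤ j + m → N • u ^ j = N • v ^ j := by
    intro m
    induction m with
    | zero =>
      intro j hj
      rw [pow_eq_zero_of_le (by omega) hu, pow_eq_zero_of_le (by omega) hv]
    | succ m ih =>
      intro j hj
      by_cases hj' : K ≤ j + m
      · exact ih j hj'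
      obtain ⟨r, hr⟩ : (X : ℤ[X]) ∣ (1 + X * q) ^ j - 1 := by
        have := sub_dvd_pow_sub_pow (1 + X * q) 1 j
        rw [one_pow] at this
        exact dvd_trans ⟨q, by ring⟩ this
      have e : (X * (1 + X * q)) ^ j = X ^ j + X ^ (j + 1) * r := by
        have : (1 + X * q) ^ j = 1 + X * r := by rw [← hr]; ring
        rw [mul_pow, this]; ring
      have h1 := aux_smul_pow N _ _ h j
      rw [← map_pow, ← map_pow, e, map_add, map_add, smul_add, smul_add,
        aux_aeval N u v (j + 1) (fun i hi => ih i (by omega)) r] at h1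
      simpa using add_right_cancel h1
  simpa using main K 1 (by omega)

/-- The polynomial `Σ (C(P-1,i-1)/i) X^i`. -/
noncomputable def gPoly (p P : ℕ) : ℤ[X] :=
  ∑ i ∈ Finset.Icc 1 (p - 1), ((P - 1).choose (i - 1) / i) • (X : ℤ[X]) ^ i

theorem gPoly_form (p P : ℕ) (hp : 2 ≤ p) : ∃ q : ℤ[X], gPoly p P = X * (1 + X * q) := by
  refine ⟨∑ i ∈ Finset.Ioc 1 (p - 1), ((P - 1).choose (i - 1) / i) • (X : ℤ[X]) ^ (i - 2), ?_⟩
  unfold gPoly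
  rw [← Finset.add_sum_Ioc_eq_sum_Icc (by omega)]
  simp only [Nat.sub_self, Nat.choose_zero_right, Nat.div_self one_pos, one_smul, pow_one]
  rw [mul_add, mul_one, ← mul_assoc, Finset.mul_sum]
  congr 1
  refine Finset.sum_congr rfl fun i hi => ?_
  rw [Finset.mem_Ioc] at hi
  obtain ⟨j, rfl⟩ : ∃ j, i = j + 2 := ⟨i - 2, by omega⟩
  rw [mul_smul_comm]
  congr 1
  simp only [Nat.add_sub_cancel]
  ring

theorem Nat.coprime_primes_lt_aux {p i : ℕ} (hp : p.Prime) (h1 : 1 ≤ i) (h2 : i < p) :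
    Nat.Coprime i p :=
  ((Nat.Prime.coprime_iff_not_dvd hp).2 (fun h => by
    have := Nat.le_of_dvd (by omega) h
    omega)).symm

theorem choose_div (p k i : ℕ) (hp : p.Prime) (h1 : 1 ≤ i) (h2 : i < p) :
    p ^ k * ((p ^ k - 1).choose (i - 1) / i) = (p ^ k).choose i := by
  have hpos : 0 < p ^ k := pow_pos hp.pos k
  have e : p ^ k * (p ^ k - 1).choose (i - 1) = (p ^ k).choose i * i := by
    have := Nat.add_one_mul_choose_eq (p ^ k - 1) (i - 1)
    rwa [Nat.sub_add_cancel hpos, Nat.sub_add_cancel h1] at this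
  have hc : Nat.Coprime i (p ^ k) :=
    Nat.Coprime.pow_right k ((Nat.coprime_primes_lt_aux hp h1 h2))
  have hd : i ∣ (p ^ k - 1).choose (i - 1) :=
    hc.dvd_of_dvd_mul_left (e ▸ Dvd.intro_left _ rfl)
  rw [← Nat.mul_div_assoc _ hd, e, Nat.mul_div_cancel _ (by omega)]

theorem one_add_pow_aux {R : Type*} [Ring R] (p k : ℕ) (hp : p.Prime) (u : R) (hu : u ^ p = 0) :
    (1 + u) ^ (p ^ k) = 1 + p ^ k • aeval u (gPoly p (p ^ k)) := by
  have h1 : (1 + u) ^ (p ^ k) = ∑ i ∈ Finset.range p, (p ^ k).choose i • u ^ i := by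
    have h0 : (1 + u) ^ (p ^ k) = ∑ i ∈ Finset.range (p ^ k + 1), (p ^ k).choose i • u ^ i := by
      rw [add_comm, (Commute.one_right u).add_pow]
      refine Finset.sum_congr rfl fun i _ => ?_
      rw [one_pow, mul_one, nsmul_eq_mul, (Nat.cast_commute _ _).eq]
    have h2 : ∀ m, p ≤ m → ∑ i ∈ Finset.range m, (p ^ k).choose i • u ^ i
        = ∑ i ∈ Finset.range p, (p ^ k).choose i • u ^ i := by
      intro m hm
      symm
      refine Finset.sum_subset (Finset.range_mono hm) fun i _ hi => ?_
      rw [Finset.mem_range, not_lt] at hi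
      rw [pow_eq_zero_of_le hi hu, smul_zero]
    have h3 : ∑ i ∈ Finset.range (p ^ k + 1), (p ^ k).choose i • u ^ i
        = ∑ i ∈ Finset.range (p ^ k + 1 + p), (p ^ k).choose i • u ^ i := by
      refine Finset.sum_subset (Finset.range_mono (by omega)) fun i _ hi => ?_
      rw [Finset.mem_range, not_lt] at hi
      rw [Nat.choose_eq_zero_of_lt (by omega), zero_smul]
    rw [h0, h3, h2 _ (by omega)]
  rw [h1, gPoly, map_sum, Finset.smul_sum]
  have h4 : Finset.range p = insert 0 (Finset.Icc 1 (p - 1)) := by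
    ext i
    have := hp.two_le
    simp only [Finset.mem_range, Finset.mem_insert, Finset.mem_Icc]
    omega
  rw [h4, Finset.sum_insert (by simp)]
  congr 1
  · simp
  refine Finset.sum_congr rfl fun i hi => ?_
  rw [Finset.mem_Icc] at hi
  have := hp.two_le
  rw [map_nsmul, smul_smul, choose_div p k i hp hi.1 (by omega), map_pow, aeval_X]

/-- The range of an endomorphism. -/
def rng {A : Type*} [AddCommGroup A] (V : AddMonoid.End A) : AddSubgroup A :=
  AddMonoidHom.range (show A →+ A from V)

theorem mem_rng {A : Type*} [AddCommGroup A] (V : AddMonoid.End A) (x : A) :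
    x ∈ rng V ↔ ∃ y, V y = x := Iff.rfl

theorem end_mul {A : Type*} [AddCommGroup A] (V W : AddMonoid.End A) (x : A) :
    (V * W) x = V (W x) := rfl

theorem end_ext {A : Type*} [AddCommGroup A] {V W : AddMonoid.End A} (h : ∀ x, V x = W x) :
    V = W := AddMonoidHom.ext h

theorem end_sum {A ι : Type*} [AddCommGroup A] (s : Finset ι) (F : ι → AddMonoid.End A) (x : A) :
    (∑ i ∈ s, F i) x = ∑ i ∈ s, F i x :=
  AddMonoidHom.finsetSum_apply (M := A) (N := A) F s x

theorem end_nsmul {A : Type*} [AddCommGroup A] (N : ℕ) (F : AddMonoid.End A) (x : A) :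
    (N • F) x = N • F x := rfl

theorem smul_lemma {R : Type*} [Ring R] (N : ℕ) (x y z : R) (h : N • z = 0) :
    N • (x + y * z) = N • x := by
  rw [smul_add, ← mul_smul_comm, h, mul_zero, add_zero]

theorem nilp_aux {A : Type*} [AddCommGroup A] (p n : ℕ) (hp : p.Prime)
    (hcard : Nat.card A = p ^ n) (V : AddMonoid.End A) (hV : IsNilpotent V) : V ^ n = 0 := by
  have hfin : Finite A := Nat.finite_of_card_ne_zero (by rw [hcard]; exact (pow_pos hp.pos n).ne')
  obtain ⟨K, hK⟩ := hV
  have hr : ∀ i, ∀ x, x ∈ rng (V ^ (i + 1)) ↔ ∃ y ∈ rng (V ^ i), V y = x := by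
    intro i x
    constructor
    · rintro ⟨y, rfl⟩
      exact ⟨(V ^ i) y, ⟨y, rfl⟩, by rw [pow_succ']; rfl⟩
    · rintro ⟨_, ⟨y, rfl⟩, rfl⟩
      exact ⟨y, by rw [pow_succ']; rfl⟩
  have hle : ∀ i, rng (V ^ (i + 1)) ≤ rng (V ^ i) := by
    rintro i _ ⟨y, rfl⟩
    exact ⟨V y, by rw [pow_succ]; rfl⟩
  have hstab : ∀ i, rng (V ^ (i + 1)) = rng (V ^ i) → V ^ i = 0 := by
    intro i hi
    have h1 : ∀ m, rng (V ^ (i + m)) = rng (V ^ i) := by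
      intro m
      induction m with
      | zero => rfl
      | succ m ih =>
        rw [← hi]
        ext x
        rw [← add_assoc, hr, hr, ih]
    have h2 := h1 K
    rw [pow_add, hK, mul_zero] at h2
    refine end_ext fun x => ?_
    have h3 : (V ^ i) x ∈ rng (V ^ i) := ⟨x, rfl⟩
    rw [← h2] at h3
    obtain ⟨y, hy⟩ := h3
    rw [← hy]
    rfl
  have hmain : ∀ i, i ≤ n → V ^ i = 0 ∨ Nat.card (rng (V ^ i)) ∣ p ^ (n - i) := by
    intro i
    induction i with
    | zero =>
      intro _
      right
      rw [Nat.sub_zero, ← hcard]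
      exact AddSubgroup.card_addSubgroup_dvd_card _
    | succ i ih =>
      intro hi
      rcases ih (by omega) with h | h
      · left
        rw [pow_succ, h, zero_mul]
      by_cases hs : rng (V ^ (i + 1)) = rng (V ^ i)
      · left
        rw [pow_succ, hstab i hs, zero_mul]
      right
      obtain ⟨s, hs1, hs2⟩ := (Nat.dvd_prime_pow hp).1 h
      have hd := AddSubgroup.card_dvd_of_le (hle i)
      rw [hs2] at hd
      obtain ⟨t, ht1, ht2⟩ := (Nat.dvd_prime_pow hp).1 hd
      have hne : t ≠ s := by
        rintro rfl
        exact hs (AddSubgroup.eq_of_le_of_card_ge (hle i) (by rw [ht2, hs2]))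
      rw [ht2]
      exact pow_dvd_pow p (by omega)
  rcases hmain n le_rfl with h | h
  · exact h
  · rw [Nat.sub_self, pow_zero, Nat.dvd_one] at h
    have hb := AddSubgroup.eq_bot_of_card_eq _ h
    refine end_ext fun x => ?_
    have h3 : (V ^ n) x ∈ rng (V ^ n) := ⟨x, rfl⟩
    rw [hb, AddSubgroup.mem_bot] at h3
    exact h3

variable {A : Type u} [AddCommGroup A]

theorem LeftBrace.circ_zero (B : LeftBrace A) (a : A) : B.circ a 0 = a := by
  have := B.circ_add a 0 0
  rw [add_zero] at this
  exact (add_left_cancel this).symm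

theorem LeftBrace.one_eq (B : LeftBrace A) : B.one = 0 := by
  rw [← B.circ_zero B.one, B.one_circ]

/-- The group `(A,∘)`. -/
abbrev LeftBrace.group (B : LeftBrace A) : Group A :=
  { mul := B.circ
    one := B.one
    inv := B.inv
    mul_assoc := B.circ_assoc
    one_mul := B.one_circ
    mul_one := B.circ_one
    inv_mul_cancel := B.inv_circ }

/-- The map `λ_a`. -/
def LeftBrace.lam (B : LeftBrace A) (a : A) : AddMonoid.End A where
  toFun x := B.circ a x - a
  map_zero' := by rw [B.circ_zero, sub_self]
  map_add' x y := by
    have := B.circ_add a x y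
    rw [← eq_sub_iff_add_eq] at this
    rw [this]; abel

theorem LeftBrace.lam_apply (B : LeftBrace A) (a x : A) : B.lam a x = B.circ a x - a := rfl

theorem LeftBrace.lam_circ (B : LeftBrace A) (a b x : A) :
    B.lam (B.circ a b) x = B.lam a (B.lam b x) := by
  have h : B.lam a (B.lam b x) = B.lam a (B.circ b x) - B.lam a b := by
    rw [← map_sub]; rfl
  rw [h]
  simp only [B.lam_apply, B.circ_assoc]
  abel

theorem LeftBrace.circ_eq (B : LeftBrace A) (a b : A) : B.circ a b = a + B.lam a b := by
  rw [B.lam_apply]; abel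

/-- The affine map of `a`, as an endomorphism of `A × ℤ`. -/
def LeftBrace.aff (B : LeftBrace A) (a : A) : AddMonoid.End (A × ℤ) where
  toFun x := (B.lam a x.1 + x.2 • a, x.2)
  map_zero' := by simp
  map_add' x y := by
    ext
    · simp only [Prod.fst_add, Prod.snd_add, map_add, add_smul]; abel
    · simp

theorem LeftBrace.aff_apply (B : LeftBrace A) (a : A) (x : A × ℤ) :
    B.aff a x = (B.lam a x.1 + x.2 • a, x.2) := rfl

theorem LeftBrace.aff_circ (B : LeftBrace A) (a b : A) :
    B.aff (B.circ a b) = B.aff a * B.aff b := by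
  refine end_ext fun x => ?_
  rw [end_mul]
  simp only [B.aff_apply, B.lam_circ]
  simp only [B.circ_eq, map_add, map_zsmul, smul_add]
  ext
  · simp only []; abel
  · rfl

theorem LeftBrace.aff_one (B : LeftBrace A) : B.aff B.one = 1 := by
  refine end_ext fun x => ?_
  rw [B.aff_apply, B.lam_apply, B.one_circ, B.one_eq]
  simp

theorem LeftBrace.aff_pow (B : LeftBrace A) (a : A) (k : ℕ) :
    B.aff (circPow B a k) = B.aff a ^ k := by
  induction k with
  | zero => rw [pow_zero]; exact B.aff_one
  | succ k ih => rw [pow_succ', ← ih]; exact B.aff_circ _ _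

theorem LeftBrace.aff_e (B : LeftBrace A) (a : A) : (B.aff a (0, 1)).1 = a := by
  simp [B.aff_apply]

theorem LeftBrace.circPow_card (B : LeftBrace A) (a : A) : circPow B a (Nat.card A) = B.one := by
  let _ := B.group
  have h : ∀ k, circPow B a k = a ^ k := by
    intro k
    induction k with
    | zero => rw [pow_zero]; rfl
    | succ k ih => rw [pow_succ', ← ih]; rfl
  rw [h, pow_card_eq_one']
  rfl

/-- `u_a = Φ_a - 1`. -/
def LeftBrace.nil (B : LeftBrace A) (a : A) : AddMonoid.End (A × ℤ) := B.aff a - 1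

theorem LeftBrace.aff_eq (B : LeftBrace A) (a : A) : B.aff a = 1 + B.nil a := by
  simp [LeftBrace.nil]

theorem LeftBrace.nil_apply (B : LeftBrace A) (a : A) (x : A × ℤ) :
    B.nil a x = ((B.lam a - 1) x.1 + x.2 • a, 0) := by
  change B.aff a x - x = _
  rw [B.aff_apply]
  change _ = (B.lam a x.1 - x.1 + x.2 • a, 0)
  ext
  · simp only [Prod.fst_sub]; abel
  · simp

theorem LeftBrace.nil_pow (B : LeftBrace A) (a : A) (k : ℕ) (x : A × ℤ) :
    (B.nil a ^ (k + 1)) x = (((B.lam a - 1) ^ k) ((B.lam a - 1) x.1 + x.2 • a), 0) := by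
  induction k with
  | zero => rw [zero_add, pow_one, B.nil_apply]; rfl
  | succ k ih =>
    rw [pow_succ', end_mul, ih, B.nil_apply]
    simp only [zero_smul, add_zero]
    rw [pow_succ' _ k]
    rfl

theorem LeftBrace.eSeq_eq (B : LeftBrace A) (a : A) (k : ℕ) :
    eSeq B a k = ((B.lam a - 1) ^ k) a := by
  induction k with
  | zero => rfl
  | succ k ih =>
    rw [pow_succ', end_mul, ← ih]
    rfl

theorem LeftBrace.lam_pow (B : LeftBrace A) (a : A) (k : ℕ) :
    B.lam (circPow B a k) = B.lam a ^ k := by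
  induction k with
  | zero =>
    refine end_ext fun x => ?_
    change B.lam B.one x = x
    rw [B.lam_apply, B.one_circ, B.one_eq, sub_zero]
  | succ k ih =>
    rw [pow_succ', ← ih]
    refine end_ext fun x => ?_
    exact B.lam_circ _ _ _

theorem LeftBrace.lam_nilp (B : LeftBrace A) (p n : ℕ) (hp : p.Prime)
    (hcard : Nat.card A = p ^ n) (a : A) : (B.lam a - 1) ^ n = 0 := by
  refine nilp_aux p n hp hcard _ ?_
  have h1 : B.lam a ^ (p ^ n) = 1 := by
    rw [← hcard, ← B.lam_pow, B.circPow_card]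
    exact B.lam_pow a 0
  have h2 : ((p : AddMonoid.End A)) ^ n = 0 := by
    rw [← Nat.cast_pow, ← hcard]
    refine end_ext fun x => ?_
    rw [AddMonoid.End.natCast_apply]
    exact card_nsmul_eq_zero'
  obtain ⟨r, hr⟩ : ((p : ℕ) : ℤ[X]) ∣ (X - 1) ^ (p ^ n) - (X ^ (p ^ n) - 1) := by
    have := Fact.mk hp
    have : (((X - 1) ^ (p ^ n) - (X ^ (p ^ n) - 1) : ℤ[X])).map (Int.castRingHom (ZMod p)) = 0 := by
      simp [sub_pow_char_pow]
    rw [← Polynomial.C_eq_natCast, Polynomial.C_dvd_iff_dvd_coeff]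
    intro i
    have h := congrArg (fun f => f.coeff i) this
    simp only [Polynomial.coeff_map, coeff_zero, eq_intCast] at h
    exact (ZMod.intCast_zmod_eq_zero_iff_dvd _ p).1 h
  have h3 := congrArg (aeval (B.lam a)) hr
  simp only [map_sub, map_pow, map_mul, aeval_X, map_one, map_natCast, h1, sub_self, sub_zero] at h3
  refine ⟨p ^ n * n, ?_⟩
  rw [pow_mul, h3, (Nat.cast_commute p _).mul_pow, h2, zero_mul]

theorem LeftBrace.nil_nilp (B : LeftBrace A) (p n : ℕ) (hp : p.Prime) (hpn : n + 1 < p)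
    (hcard : Nat.card A = p ^ n) (a : A) : B.nil a ^ p = 0 := by
  refine pow_eq_zero_of_le (m := n + 1) (by omega) ?_
  refine end_ext fun x => ?_
  rw [B.nil_pow, B.lam_nilp p n hp hcard]
  rfl

theorem LeftBrace.g_apply (B : LeftBrace A) (p P : ℕ) (a : A) :
    (aeval (B.nil a) (gPoly p P) (0, 1)).1
      = ∑ i ∈ Finset.Icc 1 (p - 1), ((P - 1).choose (i - 1) / i) • eSeq B a (i - 1) := by
  rw [gPoly, map_sum, end_sum, Prod.fst_sum]
  refine Finset.sum_congr rfl fun i hi => ?_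
  rw [Finset.mem_Icc] at hi
  obtain ⟨j, rfl⟩ : ∃ j, i = j + 1 := ⟨i - 1, by omega⟩
  rw [map_nsmul, map_pow, aeval_X, end_nsmul, B.nil_pow, B.eSeq_eq]
  simp

/-- If `p^k d = 0` then `p^k u_d = 0`. -/
theorem LeftBrace.L0 (B : LeftBrace A) (p n : ℕ) (hp : p.Prime) (hpn : n + 1 < p)
    (hcard : Nat.card A = p ^ n) (k : ℕ) (d : A) (hd : p ^ k • d = 0) :
    p ^ k • B.nil d = 0 := by
  have h1 := one_add_pow_aux p k hp (B.nil d) (B.nil_nilp p n hp hpn hcard d)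
  rw [← B.aff_eq, ← B.aff_pow] at h1
  have h2 : circPow B d (p ^ k) = B.one := by
    rw [← B.aff_e (circPow B d (p ^ k)), h1, B.one_eq]
    change ((0 : A), (1 : ℤ)).1 + p ^ k • (aeval (B.nil d) (gPoly p (p ^ k)) (0, 1)).1 = 0
    rw [B.g_apply, zero_add, Finset.smul_sum]
    refine Finset.sum_eq_zero fun i _ => ?_
    rw [smul_comm, B.eSeq_eq, ← map_nsmul, hd, map_zero, smul_zero]
  rw [h2, B.aff_one] at h1
  have h3 : p ^ k • aeval (B.nil d) (gPoly p (p ^ k)) = 0 := by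
    simpa using h1
  obtain ⟨q, hq⟩ := gPoly_form p (p ^ k) hp.two_le
  rw [hq] at h3
  have := aux_inv (p ^ k) p (B.nil d) 0 (B.nil_nilp p n hp hpn hcard d)
    (zero_pow hp.pos.ne') q (by rw [h3, map_mul, aeval_X, zero_mul, smul_zero])
  rw [this, smul_zero]

theorem LeftBrace.L1 (B : LeftBrace A) (p n : ℕ) (hp : p.Prime) (hpn : n + 1 < p)
    (hcard : Nat.card A = p ^ n) (k : ℕ) (a b : A) (hab : p ^ k • a = p ^ k • b) :
    p ^ k • B.nil a = p ^ k • B.nil b := by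
  obtain ⟨d, rfl⟩ : ∃ d, a = B.circ b d := by
    let _ := B.group
    exact ⟨b⁻¹ * a, (mul_inv_cancel_left b a).symm⟩
  have hd : p ^ k • d = 0 := by
    rw [B.circ_eq, smul_add, add_eq_left, ← map_nsmul] at hab
    have h := congrArg (B.lam (B.inv b)) hab
    rw [← B.lam_circ, B.inv_circ, map_zero, B.lam_apply, B.one_circ, B.one_eq, sub_zero] at h
    exact h
  have h := B.L0 p n hp hpn hcard k d hd
  have e : B.nil (B.circ b d) = B.nil b + B.aff b * B.nil d := by
    simp only [LeftBrace.nil, B.aff_circ, mul_sub]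
    rw [mul_one]
    abel
  rw [e]
  exact smul_lemma _ _ _ _ h

theorem LeftBrace.nil_e (B : LeftBrace A) (a : A) : (B.nil a (0, 1)).1 = a := by
  simp [B.nil_apply]

theorem LeftBrace.fMap_eq (B : LeftBrace A) (p : ℕ) (a : A) :
    fMap B p a = (aeval (B.nil a) (gPoly p p) (0, 1)).1 := (B.g_apply p p a).symm

theorem LeftBrace.f_wd (B : LeftBrace A) (p n : ℕ) (hp : p.Prime) (hpn : n + 1 < p)
    (hcard : Nat.card A = p ^ n) (k : ℕ) (a b : A) (hab : p ^ k • a = p ^ k • b) :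
    p ^ k • fMap B p a = p ^ k • fMap B p b := by
  have h := B.L1 p n hp hpn hcard k a b hab
  have h2 := aux_aeval (p ^ k) (B.nil a) (B.nil b) 0 (fun i _ => aux_smul_pow _ _ _ h i) (gPoly p p)
  rw [pow_zero, one_mul] at h2
  have h3 := congrArg (fun F : AddMonoid.End (A × ℤ) => (F (0, 1)).1) h2
  rw [B.fMap_eq, B.fMap_eq]
  exact h3

theorem LeftBrace.f_inj (B : LeftBrace A) (p n : ℕ) (hp : p.Prime) (hpn : n + 1 < p)
    (hcard : Nat.card A = p ^ n) (k : ℕ) (a b : A)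
    (hab : p ^ (k + 1) • fMap B p a = p ^ (k + 1) • fMap B p b) :
    p ^ (k + 1) • a = p ^ (k + 1) • b := by
  have h1 : ∀ x, B.nil (circPow B x p) = p • aeval (B.nil x) (gPoly p p) := by
    intro x
    have h1 := one_add_pow_aux p 1 hp (B.nil x) (B.nil_nilp p n hp hpn hcard x)
    rw [← B.aff_eq, ← B.aff_pow, B.aff_eq, pow_one] at h1
    exact add_left_cancel h1
  have h2 : ∀ x, circPow B x p = p • fMap B p x := by
    intro x
    rw [← B.nil_e (circPow B x p), h1, B.fMap_eq]
    rfl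
  have h3 : p ^ k • circPow B a p = p ^ k • circPow B b p := by
    rw [h2, h2, smul_smul, smul_smul, ← pow_succ, hab]
  have h4 := B.L1 p n hp hpn hcard k _ _ h3
  rw [h1, h1, smul_smul, smul_smul, ← pow_succ] at h4
  obtain ⟨q, hq⟩ := gPoly_form p p hp.two_le
  rw [hq] at h4
  have h5 := aux_inv _ p _ _ (B.nil_nilp p n hp hpn hcard a) (B.nil_nilp p n hp hpn hcard b) q h4
  have h6 := congrArg (fun F : AddMonoid.End (A × ℤ) => (F (0, 1)).1) h5
  change p ^ (k + 1) • (B.nil a (0, 1)).1 = p ^ (k + 1) • (B.nil b (0, 1)).1 at h6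
  rwa [B.nil_e, B.nil_e] at h6

theorem qmk_eq_iff (k : ℕ) (a b : A) : qmk k a = qmk k b ↔ k • a = k • b := by
  unfold qmk
  rw [QuotientAddGroup.eq]
  change k • (-a + b) = 0 ↔ _
  rw [smul_add, smul_neg, neg_add_eq_zero]

theorem iterate_factorial {Q : Type*} [Finite Q] (F : Q → Q) (hF : Function.Injective F) (m : ℕ)
    (hm : Nat.card Q ≤ m) (x : Q) : F^[m.factorial] x = x := by
  classical
  have := Fintype.ofFinite Q
  let e : Equiv.Perm Q := Equiv.ofBijective F (Finite.injective_iff_bijective.1 hF)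
  have h1 : orderOf e ∣ m.factorial := by
    refine (orderOf_dvd_card (x := e)).trans ?_
    rw [Fintype.card_perm]
    exact Nat.factorial_dvd_factorial (by rwa [← Nat.card_eq_fintype_card])
  have h2 := orderOf_dvd_iff_pow_eq_one.1 h1
  have h3 := congrArg (fun g : Equiv.Perm Q => g x) h2
  simpa [Equiv.Perm.iterate_eq_pow, e] using (congrFun (Equiv.Perm.iterate_eq_pow e m.factorial) x).trans h3

end Helpers

/-- `[f^{(p^p!)}(a)] = [a]` in `A/ann(p²)`, where `f^{(i)}` is the `i`-fold
iterate of `f`. -/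
theorem stmt_9 (p n : ℕ) (hp : p.Prime) (hpn : n + 1 < p)
    (A : Type u) [AddCommGroup A] (B : LeftBrace A) (hcard : Nat.card A = p ^ n)
    (a : A) :
    qmk (p ^ 2) ((fun x => fMap B p x)^[(p ^ p).factorial] a) = qmk (p ^ 2) a := by
  have hfin : Finite A := Nat.finite_of_card_ne_zero (by rw [hcard]; exact (pow_pos hp.pos n).ne')
  let F : A ⧸ annSub A (p ^ 2) → A ⧸ annSub A (p ^ 2) := fun y => qmk (p ^ 2) (fMap B p (Quotient.out y))
  have hout : ∀ y : A ⧸ annSub A (p ^ 2), qmk (p ^ 2) (Quotient.out y) = y := fun y =>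
    QuotientAddGroup.out_eq' y
  have hF : ∀ x, qmk (p ^ 2) (fMap B p x) = F (qmk (p ^ 2) x) := by
    intro x
    rw [qmk_eq_iff]
    refine B.f_wd p n hp hpn hcard 2 _ _ ?_
    rw [← qmk_eq_iff, hout]
  have hinj : Function.Injective F := by
    intro y z hyz
    have h := (qmk_eq_iff _ _ _).1 hyz
    have h2 := B.f_inj p n hp hpn hcard 1 _ _ h
    rw [← hout y, ← hout z]
    exact (qmk_eq_iff _ _ _).2 h2
  have hsc : Function.Semiconj (qmk (p ^ 2)) (fun x => fMap B p x) F := hF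
  rw [(hsc.iterate_right _).eq]
  refine iterate_factorial F hinj _ ?_ _
  calc Nat.card (A ⧸ annSub A (p ^ 2)) ≤ Nat.card A :=
        Nat.card_le_card_of_surjective (qmk (p ^ 2)) (fun y => ⟨_, hout y⟩)
    _ = p ^ n := hcard
    _ ≤ p ^ p := Nat.pow_le_pow_right hp.pos (by omega)
end

section
/- Let (A,+,∘) be a left brace of cardinality p^n, where p is prime and p > n+1. Let γ be a primitive root modulo p^p and ξ = γ^(p^(p−1)). Define on A/ann(p^2) the operation [x]•[y] = Σ_{i=0}^{p−2} ξ^(p−1−i)·([ξ^i·x]⊙[y]). Then (A/ann(p^2), +, •) is a pre-Lie ring: • is biadditive and satisfies ([x]•[y])•[z] − [x]•([y]•[z]) = ([y]•[x])•[z] − [y]•([x]•[z]) for all x, y, z ∈ A. -/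
universe u

open Polynomial

section LazardAbs

/-- filtration properties -/
structure LzFilt {K E : Type*} [CommRing K] [Ring E] [Algebra K E]
    (R : ℕ → Submodule K E) (N : ℕ) : Prop where
  anti : Antitone R
  mul : ∀ {i j : ℕ} {x y : E}, x ∈ R i → y ∈ R j → x * y ∈ R (i + j)
  one : (1 : E) ∈ R 0
  zero : ∀ x ∈ R N, x = 0

variable {K E : Type*} [CommRing K] [Ring E] [Algebra K E]
  {R : ℕ → Submodule K E} {N : ℕ}

/-- filtered polynomial functions -/
def LzQ (R : ℕ → Submodule K E) : ℕ → ℕ → (ℕ → E) → Prop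
  | 0, i, F => ∀ t, F t ∈ R i
  | k + 1, i, F => (∀ t, F t ∈ R i) ∧ LzQ R k (i + 1) (fun t => F (t + 1) - F t)

theorem LzQ.mem {k i : ℕ} {F : ℕ → E} (h : LzQ R k i F) (t : ℕ) : F t ∈ R i := by
  cases k with
  | zero => exact h t
  | succ k => exact h.1 t

theorem LzQ.add {k : ℕ} : ∀ {i : ℕ} {F G : ℕ → E}, LzQ R k i F → LzQ R k i G →
    LzQ R k i (fun t => F t + G t) := by
  induction k with
  | zero => intro i F G hF hG t; exact add_mem (hF t) (hG t)
  | succ k ih =>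
    intro i F G hF hG
    refine ⟨fun t => add_mem (hF.1 t) (hG.1 t), ?_⟩
    have := ih hF.2 hG.2
    convert this using 2
    rw [add_sub_add_comm]

theorem LzQ.smul {k : ℕ} (c : K) : ∀ {i : ℕ} {F : ℕ → E}, LzQ R k i F →
    LzQ R k i (fun t => c • F t) := by
  induction k with
  | zero => intro i F hF t; exact (R i).smul_mem c (hF t)
  | succ k ih =>
    intro i F hF
    refine ⟨fun t => (R i).smul_mem c (hF.1 t), ?_⟩
    have := ih hF.2
    convert this using 2
    rw [smul_sub]

theorem LzQ.zero {k : ℕ} : ∀ {i : ℕ}, LzQ R k i (fun _ => 0) := by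
  induction k with
  | zero => intro i t; exact zero_mem _
  | succ k ih =>
    intro i
    refine ⟨fun t => zero_mem _, ?_⟩
    convert ih (i := i + 1) using 2
    simp

theorem LzQ.const {k : ℕ} {i : ℕ} {x : E} (hx : x ∈ R i) : LzQ R k i (fun _ => x) := by
  cases k with
  | zero => intro t; exact hx
  | succ k =>
    refine ⟨fun t => hx, ?_⟩
    simp only [sub_self]
    exact LzQ.zero

theorem LzQ.shift {k : ℕ} : ∀ {i : ℕ} {F : ℕ → E}, LzQ R k i F →
    LzQ R k i (fun t => F (t + 1)) := by
  induction k with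
  | zero => intro i F hF t; exact hF _
  | succ k ih =>
    intro i F hF
    exact ⟨fun t => hF.1 _, ih hF.2⟩

theorem LzQ.mono (hR : LzFilt R N) {k : ℕ} : ∀ {i j : ℕ} {F : ℕ → E}, j ≤ i → LzQ R k i F →
    LzQ R k j F := by
  induction k with
  | zero => intro i j F hij hF t; exact hR.anti hij (hF _)
  | succ k ih =>
    intro i j F hij hF
    exact ⟨fun t => hR.anti hij (hF.1 _), ih (by omega) hF.2⟩

theorem LzQ.level {k : ℕ} : ∀ {i : ℕ} {F : ℕ → E}, LzQ R (k + 1) i F → LzQ R k i F := by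
  induction k with
  | zero => intro i F hF t; exact hF.1 t
  | succ k ih =>
    intro i F hF
    exact ⟨hF.1, ih hF.2⟩

theorem LzQ.mul (hR : LzFilt R N) {k : ℕ} : ∀ {i j : ℕ} {F G : ℕ → E}, LzQ R k i F → LzQ R k j G →
    LzQ R k (i + j) (fun t => F t * G t) := by
  induction k with
  | zero => intro i j F G hF hG t; exact hR.mul (hF t) (hG t)
  | succ k ih =>
    intro i j F G hF hG
    refine ⟨fun t => hR.mul (hF.1 t) (hG.1 t), ?_⟩
    have h1 := ih hF.2 hG.level
    have h2 := ih hF.shift.level hG.2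
    rw [show i + 1 + j = i + j + 1 by ring] at h1
    rw [show i + (j + 1) = i + j + 1 by ring] at h2
    convert h1.add h2 using 2
    noncomm_ring

theorem LzQ.natmul (hR : LzFilt R N) {k : ℕ} : ∀ {i : ℕ} {F : ℕ → E}, LzQ R k (i + 1) F →
    LzQ R k i (fun t => (t : K) • F t) := by
  induction k with
  | zero => intro i F hF t; exact hR.anti (Nat.le_succ i) ((R (i+1)).smul_mem _ (hF t))
  | succ k ih =>
    intro i F hF
    refine ⟨fun t => hR.anti (Nat.le_succ i) ((R (i+1)).smul_mem _ (hF.1 t)), ?_⟩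
    convert (ih hF.2).add hF.shift.level using 2
    push_cast
    rw [smul_sub, add_smul, one_smul]
    abel

theorem LzQ.pow (hR : LzFilt R N) {k i : ℕ} {F : ℕ → E} (hF : LzQ R k i F) (m : ℕ) :
    LzQ R k (m * i) (fun t => F t ^ m) := by
  induction m with
  | zero => simpa using LzQ.const hR.one
  | succ m ih =>
    have := ih.mul hR hF
    simp only [← pow_succ] at this
    convert this using 1
    ring

theorem LzQ.addmem (hR : LzFilt R N) (M : AddSubgroup E) {k : ℕ} : ∀ {i : ℕ} {F : ℕ → E},
    i + k = N → LzQ R k i F → (∀ t < k, F t ∈ M) → ∀ t, F t ∈ M := by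
  induction k with
  | zero =>
    intro i F hi hF _ t
    rw [hR.zero (F t) (by have := hF t; rwa [← hi])]
    exact zero_mem _
  | succ k ih =>
    intro i F hi hF hM t
    have := ih (by omega) hF.2 (fun t ht => M.sub_mem (hM _ (by omega)) (hM _ (by omega)))
    induction t with
    | zero => exact hM 0 (by omega)
    | succ t iht =>
      have h := M.add_mem (this t) iht
      simpa using h

theorem LzQ.vanish (j : ℕ) : ∀ {i k : ℕ} {F : ℕ → E}, j ≤ k → LzQ R k i F →
    (∀ t < j, F t = 0) → F j ∈ R (i + j) := by
  induction j with
  | zero => intro i k F _ hF _; exact hF.mem 0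
  | succ j ih =>
    intro i k F hk hF hv
    obtain ⟨k, rfl⟩ : ∃ k', k = k' + 1 := ⟨k - 1, by omega⟩
    have := ih (by omega) hF.2 (fun t ht => by simp [hv t (by omega), hv (t+1) (by omega)])
    simp only [hv j (by omega), sub_zero] at this
    convert this using 2
    ring

theorem LzFilt.pow_sub_one (hR : LzFilt R N) {m : ℕ} {g : E} (hg : g - 1 ∈ R m) (c : ℕ) :
    g ^ c - 1 ∈ R m := by
  have hg0 : g ∈ R 0 := by
    have := add_mem (hR.anti (Nat.zero_le m) hg) hR.one
    simpa using this
  induction c with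
  | zero => simp
  | succ c ih =>
    have h1 := hR.mul hg0 ih
    rw [zero_add] at h1
    have := add_mem h1 hg
    convert this using 1
    rw [pow_succ']; noncomm_ring

theorem LzQ.choosePow (hR : LzFilt R N) {m : ℕ} {g : E} (hg : g - 1 ∈ R m) (j : ℕ) :
    j ≤ m → ∀ k, LzQ R k (m - j) (fun t => g ^ (t.choose j) - 1) := by
  induction j with
  | zero => intro _ k; simpa using LzQ.const hg
  | succ j ihj =>
    intro hj k
    have hmem : ∀ t : ℕ, g ^ (t.choose (j+1)) - 1 ∈ R (m - (j + 1)) := fun t =>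
      hR.anti (Nat.sub_le _ _) (hR.pow_sub_one hg _)
    induction k with
    | zero => exact hmem
    | succ k ih =>
      refine ⟨hmem, ?_⟩
      have h0 : LzQ R k 0 (fun t => g ^ (t.choose (j+1))) := by
        have := (ih.mono hR (Nat.zero_le _)).add (LzQ.const hR.one)
        simpa using this
      have := h0.mul hR (ihj (by omega) k)
      convert this using 1
      · omega
      · funext t
        show (g ^ ((t + 1).choose (j + 1)) - 1) - (g ^ (t.choose (j + 1)) - 1) = _
        rw [Nat.choose_succ_succ', mul_sub, mul_one, sub_sub_sub_cancel_right, ← pow_add, add_comm]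

/-- Interpolation in groups. -/
theorem LzQ.grp (hR : LzFilt R N) (G : Submonoid E) (q : ℕ) (hq : 0 < q) (hG1 : ∀ g ∈ G, g - 1 ∈ R 1)
    (hGq : ∀ g ∈ G, g ^ q = 1) (d : ℕ) : ∀ (j : ℕ) (F : ℕ → E), j + d = N → (∀ k, LzQ R k 0 F) →
      (∀ t < N, F t ∈ G) → (∀ t < j, F t = 1) → ∀ t, F t ∈ G := by
  induction d with
  | zero =>
    intro j F hj hF hFG hF1 t
    have h := LzQ.addmem (k := N) (i := 0) (F := fun t => F t + (-1 : K) • 1) hR ⊥ (by omega)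
      ((hF _).add ((LzQ.const hR.one).smul (-1 : K))) (fun t ht => by
        simp [hF1 t (by omega)]) t
    have h' : F t = 1 := by
      rw [AddSubgroup.mem_bot] at h
      simp only [neg_smul, one_smul] at h
      rwa [← sub_eq_add_neg, sub_eq_zero] at h
    rw [h']; exact one_mem _
  | succ d ih =>
    intro j F hj hF hFG hF1 t
    have hg := hFG j (by omega)
    have hgj : F j - 1 ∈ R j := by
      rcases Nat.eq_zero_or_pos j with rfl | hj0
      · exact hR.anti (Nat.zero_le 1) (hG1 _ hg)
      have h := LzQ.vanish (k := j) (i := 0) j (F := fun t => F t + (-1 : K) • 1) le_rfl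
        ((hF _).add ((LzQ.const hR.one).smul (-1 : K))) (fun t ht => by
        simp [hF1 t (by omega)])
      simpa [sub_eq_add_neg] using h
    set g := F j with hgdef
    have hgi : (g ^ (q - 1)) - 1 ∈ R j := hR.pow_sub_one hgj _
    have hgg : g * g ^ (q - 1) = 1 := by
      rw [← pow_succ', Nat.sub_add_cancel hq, hGq g hg]
    have hgg' : g ^ (q - 1) * g = 1 := by
      rw [← pow_succ, Nat.sub_add_cancel hq, hGq g hg]
    have key := ih (j + 1) (fun t => F t * (g ^ (q - 1)) ^ (t.choose j)) (by omega)
      (fun k => by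
        have h0 : LzQ R k 0 (fun t => (g ^ (q - 1)) ^ (t.choose j)) := by
          have := ((LzQ.choosePow hR hgi j le_rfl k).mono hR (Nat.zero_le _)).add (LzQ.const hR.one)
          simpa using this
        exact (hF k).mul hR h0)
      (fun t ht => mul_mem (hFG t ht) (pow_mem (pow_mem hg _) _))
      (fun t ht => by
        rcases Nat.lt_succ_iff_lt_or_eq.1 ht with h | rfl
        · simp [hF1 t h, Nat.choose_eq_zero_of_lt h]
        · simp only [Nat.choose_self, pow_one]
          exact hgg) t
    have := mul_mem key (pow_mem hg (t.choose j))
    rw [mul_assoc, ← Commute.mul_pow (by rw [Commute, SemiconjBy, hgg, hgg']), hgg', one_pow, mul_one]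
      at this
    exact this

/-- filtered polynomials -/
def LzP (R : ℕ → Submodule K E) (i : ℕ) (f : E[X]) : Prop := ∀ k, f.coeff k ∈ R (k + i)

/-- evaluation at a natural number -/
noncomputable def lzEv (t : ℕ) : E[X] →+* E :=
  eval₂RingHom' (RingHom.id E) (t : E) (fun a => Nat.commute_cast a t)

theorem lzEv_apply (t : ℕ) (f : E[X]) : lzEv t f = f.eval (t : E) := rfl

theorem LzP.Q (hR : LzFilt R N) {i : ℕ} {f : E[X]} (hf : LzP R i f) (k : ℕ) :
    LzQ R k i (fun t => lzEv t f) := by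
  have h1 : ∀ (m : ℕ) (i : ℕ) (x : E), x ∈ R (m + i) →
      LzQ R k i (fun t => ((t : K) ^ m) • x) := by
    intro m
    induction m with
    | zero => intro i x hx; simpa using LzQ.const (by simpa using hx)
    | succ m ih =>
      intro i x hx
      have := (ih (i + 1) x (by convert hx using 2; ring)).natmul hR
      simp only [smul_smul, ← pow_succ'] at this
      exact this
  have h2 : ∀ n : ℕ, LzQ R k i (fun t => ∑ m ∈ Finset.range n, ((t : K) ^ m) • f.coeff m) := by
    intro n
    induction n with
    | zero => simpa using LzQ.zero
    | succ n ih =>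
      simp only [Finset.sum_range_succ]
      exact ih.add (h1 n i _ (hf n))
  convert h2 (f.natDegree + 1) using 2 with t
  rw [lzEv_apply, eval_eq_sum_range]
  refine Finset.sum_congr rfl fun m _ => ?_
  rw [Algebra.smul_def, map_pow, map_natCast]
  exact ((Nat.commute_cast (f.coeff m) t).pow_right m)

theorem LzP.mul (hR : LzFilt R N) {i j : ℕ} {f g : E[X]} (hf : LzP R i f) (hg : LzP R j g) :
    LzP R (i + j) (f * g) := by
  intro k
  rw [coeff_mul]
  refine sum_mem fun x hx => ?_
  rw [Finset.HasAntidiagonal.mem_antidiagonal] at hx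
  have := hR.mul (hf x.1) (hg x.2)
  convert this using 2
  omega

theorem LzP.C (i : ℕ) {x : E} (hx : x ∈ R i) : LzP R i (C x) := by
  intro k
  rw [coeff_C]
  split_ifs with h
  · subst h; simpa using hx
  · exact zero_mem _

theorem LzP.add {i : ℕ} {f g : E[X]} (hf : LzP R i f) (hg : LzP R i g) : LzP R i (f + g) := by
  intro k
  rw [coeff_add]; exact add_mem (hf k) (hg k)

theorem LzP.mono (hR : LzFilt R N) {i j : ℕ} (h : j ≤ i) {f : E[X]} (hf : LzP R i f) :
    LzP R j f := fun k => hR.anti (by omega) (hf k)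

theorem LzP.pow (hR : LzFilt R N) {f : E[X]} (hf : LzP R 0 f) (m : ℕ) : LzP R 0 (f ^ m) := by
  induction m with
  | zero => rw [pow_zero, ← C_1]; exact LzP.C 0 hR.one
  | succ m ih => rw [pow_succ]; exact ih.mul hR hf

theorem LzP.mulX {i : ℕ} {f : E[X]} (hf : LzP R (i + 1) f) : LzP R i (f * X) := by
  intro k
  cases k with
  | zero => simp
  | succ k =>
    rw [coeff_mul_X]
    have := hf k
    convert this using 2
    omega

theorem LzP.divX {i : ℕ} {f : E[X]} (hf : LzP R i f) : LzP R (i + 1) f.divX := by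
  intro k
  rw [coeff_divX]
  have := hf (k + 1)
  convert this using 2
  omega

/-- truncated exponential -/
noncomputable def lzExp (K : Type*) {E : Type*} [CommRing K] [Ring E] [Algebra K E] (N : ℕ) (x : E) : E :=
  ∑ k ∈ Finset.range N, Ring.inverse ((k.factorial : ℕ) : K) • x ^ k

theorem LzFilt.pow_mem (hR : LzFilt R N) {x : E} {i : ℕ} (hx : x ∈ R i) (k : ℕ) : x ^ k ∈ R (k * i) := by
  induction k with
  | zero => simpa using hR.one
  | succ k ih =>
    rw [pow_succ, Nat.succ_mul]; exact hR.mul ih hx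

theorem lz_unit_fac (hinv : ∀ t : ℕ, 1 ≤ t → t ≤ N → ∃ s : ℕ, (s : K) * (t : K) = 1) (k : ℕ) (hk : k ≤ N) :
    IsUnit ((k.factorial : ℕ) : K) := by
  induction k with
  | zero => simp
  | succ k ih =>
    rw [Nat.factorial_succ, Nat.cast_mul]
    obtain ⟨s, hs⟩ := hinv (k+1) (by omega) hk
    exact (IsUnit.of_mul_eq_one_right _ hs).mul (ih (by omega))

theorem lz_choose (s t k : ℕ) (hst : (s : K) * (t : K) = 1) :
    ((s.choose k : ℕ) : K) * (t : K) ^ k * (k.factorial : K) =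
      ∏ j ∈ Finset.range k, (1 - (j : K) * (t : K)) := by
  have h1 : ((s.descFactorial k : ℕ) : K) * (t : K) ^ k = ∏ j ∈ Finset.range k, (1 - (j : K) * (t : K)) := by
    rw [← descPochhammer_eval_eq_descFactorial, descPochhammer_eval_eq_prod_range]
    rw [← Finset.card_range k, ← Finset.prod_const, Finset.card_range, ← Finset.prod_mul_distrib]
    refine Finset.prod_congr rfl fun j _ => ?_
    rw [sub_mul, hst]
  rw [← h1, Nat.descFactorial_eq_factorial_mul_choose]
  push_cast; ring

theorem lz_key (hR : LzFilt R N) (G : Submonoid E) (q : ℕ) (hq : 0 < q) (hG1 : ∀ g ∈ G, g - 1 ∈ R 1)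
    (hGq : ∀ g ∈ G, g ^ q = 1) (hqK : (q : K) = 0)
    (hinv : ∀ t : ℕ, 1 ≤ t → t ≤ N → ∃ s : ℕ, (s : K) * (t : K) = 1)
    (f : E[X]) (hf : LzP R 0 f) (hf0 : f.coeff 0 = 1) (hfG : ∀ t : ℕ, lzEv t f ∈ G) :
    lzExp K N (f.coeff 1) ∈ G := by
  set h : ℕ → E := fun t => lzEv t f.divX with hh
  have hfh : ∀ t : ℕ, lzEv t f = 1 + (t : K) • h t := by
    intro t
    conv_lhs => rw [← divX_mul_X_add f]
    rw [map_add, map_mul, hf0, lzEv_apply t (C 1), lzEv_apply t X, eval_C, eval_X, Algebra.smul_def,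
      map_natCast, add_comm, (Nat.commute_cast _ t).eq]
  have hhQ : ∀ k, LzQ R k 1 h := fun k => by simpa using (hf.divX).Q hR k
  set H : ℕ → E := fun t => ∑ k ∈ Finset.range N, Ring.inverse ((k.factorial : ℕ) : K) •
    (∏ j ∈ Finset.range k, (1 - (j : K) * (t : K))) • h t ^ k with hH
  have hHQ : ∀ l, LzQ R l 0 H := by
    intro l
    have h1 : ∀ (k i : ℕ) (F : ℕ → E), LzQ R l (k + i) F →
        LzQ R l i (fun t => (∏ j ∈ Finset.range k, (1 - (j : K) * (t : K))) • F t) := by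
      intro k
      induction k with
      | zero => intro i F hF; simpa using hF
      | succ k ih =>
        intro i F hF
        have h2 := ih (i + 1) F (by convert hF using 1; ring)
        have h3 := (h2.mono hR (Nat.le_succ i)).add ((h2.natmul hR).smul (-(k : K)))
        convert h3 using 2 with t
        rw [Finset.prod_range_succ, smul_smul, smul_smul, ← add_smul]
        congr 1; ring
    have h2 : ∀ n : ℕ, LzQ R l 0 (fun t => ∑ k ∈ Finset.range n, Ring.inverse ((k.factorial : ℕ) : K) •
        (∏ j ∈ Finset.range k, (1 - (j : K) * (t : K))) • h t ^ k) := by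
      intro n
      induction n with
      | zero => simpa using LzQ.zero
      | succ n ih =>
        simp only [Finset.sum_range_succ]
        refine ih.add (LzQ.smul _ (h1 n 0 _ ?_))
        simpa using (hhQ l).pow hR n
    exact h2 N
  have hHG : ∀ t : ℕ, 1 ≤ t → t ≤ N → H t ∈ G := by
    intro t ht1 htN
    obtain ⟨s, hs⟩ := hinv t ht1 htN
    have hu := pow_mem (hfG t) s
    have hz : ∀ k, N ≤ k → h t ^ k = 0 := by
      intro k hk
      have := hR.pow_mem ((hhQ 0).mem t) k
      exact hR.zero _ (hR.anti (by omega) this)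
    have e : (lzEv t f) ^ s = H t := by
      rw [hfh, add_comm, (Commute.one_right _).add_pow]
      have e1 : ∀ k, ((t : K) • h t) ^ k * 1 ^ (s - k) * ((s.choose k : ℕ) : E)
          = (((s.choose k : ℕ) : K) * (t : K) ^ k) • h t ^ k := by
        intro k
        rw [one_pow, mul_one, _root_.smul_pow, mul_smul, Algebra.smul_def ((s.choose k : ℕ) : K), map_natCast,
          (Nat.commute_cast _ _).eq]
      simp only [e1]
      have e2 : ∑ k ∈ Finset.range (s + 1), (((s.choose k : ℕ) : K) * (t : K) ^ k) • h t ^ k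
          = ∑ k ∈ Finset.range (s + 1 + N), (((s.choose k : ℕ) : K) * (t : K) ^ k) • h t ^ k := by
        refine Finset.sum_subset (Finset.range_mono (by omega)) fun k _ hk => ?_
        rw [Nat.choose_eq_zero_of_lt (by simpa using hk)]; simp
      have e3 : ∑ k ∈ Finset.range N, (((s.choose k : ℕ) : K) * (t : K) ^ k) • h t ^ k
          = ∑ k ∈ Finset.range (s + 1 + N), (((s.choose k : ℕ) : K) * (t : K) ^ k) • h t ^ k := by
        refine Finset.sum_subset (Finset.range_mono (by omega)) fun k _ hk => ?_
        rw [hz k (by simpa using hk), smul_zero]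
      rw [e2, ← e3, hH]
      refine Finset.sum_congr rfl fun k hk => ?_
      rw [← lz_choose s t k hs, smul_smul]
      congr 1
      have := Ring.inverse_mul_cancel _ (lz_unit_fac hinv k (by have := Finset.mem_range.1 hk; omega))
      linear_combination (-((s.choose k : ℕ) : K) * (t : K) ^ k) * this
    rwa [e] at hu
  have := LzQ.grp hR G q hq hG1 hGq N 0 (fun t => H (t + 1)) (by omega) (fun k => (hHQ k).shift)
    (fun t ht => hHG _ (by omega) (by omega)) (fun t ht => by omega) (q - 1)
  simp only [Nat.sub_add_cancel hq] at this
  have hqE : (q : E) = 0 := by rw [← map_natCast (algebraMap K E), hqK, map_zero]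
  have hhq : h q = f.coeff 1 := by
    rw [hh]; simp only [lzEv_apply, hqE, ← coeff_zero_eq_eval_zero, coeff_divX, zero_add]
  convert this using 1
  simp only [hH, lzExp, hhq, hqK, mul_zero, sub_zero, Finset.prod_const_one, one_smul]

theorem lz_coeff1_pow (f : E[X]) (hf0 : f.coeff 0 = 1) (m : ℕ) :
    (f ^ m).coeff 0 = 1 ∧ (f ^ m).coeff 1 = m * f.coeff 1 := by
  induction m with
  | zero => simp [coeff_one]
  | succ m ih =>
    rw [pow_succ]
    refine ⟨by rw [mul_coeff_zero, ih.1, hf0, mul_one], ?_⟩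
    rw [mul_coeff_one, ih.1, ih.2, hf0]
    push_cast; noncomm_ring

/-- the tangent set of `G` -/
def lzL (R : ℕ → Submodule K E) (G : Submonoid E) : Set E :=
  {x | ∃ f : E[X], LzP R 0 f ∧ f.coeff 0 = 1 ∧ (∀ t : ℕ, lzEv t f ∈ G) ∧ f.coeff 1 = x}

theorem lzL_add (hR : LzFilt R N) (G : Submonoid E) {x y : E} (hx : x ∈ lzL R G) (hy : y ∈ lzL R G) :
    x + y ∈ lzL R G := by
  obtain ⟨f, hf, hf0, hfG, rfl⟩ := hx
  obtain ⟨g, hg, hg0, hgG, rfl⟩ := hy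
  refine ⟨f * g, by simpa using hf.mul hR hg, by rw [mul_coeff_zero, hf0, hg0, mul_one],
    fun t => by rw [map_mul]; exact mul_mem (hfG t) (hgG t), ?_⟩
  rw [mul_coeff_one, hf0, hg0]; simp [add_comm]

theorem lzL_R {G : Submonoid E} {x : E} (hx : x ∈ lzL R G) : x ∈ R 1 := by
  obtain ⟨f, hf, hf0, hfG, rfl⟩ := hx
  simpa using hf 1

theorem lzL_zero (hR : LzFilt R N) (G : Submonoid E) : (0 : E) ∈ lzL R G := by
  refine ⟨1, by rw [← C_1]; exact LzP.C 0 hR.one, by simp, fun t => by simp [one_mem], ?_⟩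
  simp [coeff_one]

theorem lzL_nsmul (hR : LzFilt R N) (G : Submonoid E) {x : E} (hx : x ∈ lzL R G) (m : ℕ) :
    (m : K) • x ∈ lzL R G := by
  induction m with
  | zero => simpa using lzL_zero hR G
  | succ m ih => push_cast; rw [add_smul, one_smul]; exact lzL_add hR G ih hx

theorem lzL_neg (hR : LzFilt R N) (G : Submonoid E) (q : ℕ) (hq : 0 < q) (hqK : (q : K) = 0)
    {x : E} (hx : x ∈ lzL R G) : -x ∈ lzL R G := by
  have := lzL_nsmul (K := K) hR G hx (q - 1)
  rw [Nat.cast_sub hq, hqK] at this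
  simpa using this

theorem lzL_conj (hR : LzFilt R N) (G : Submonoid E) (hG1 : ∀ g ∈ G, g - 1 ∈ R 1)
    {x g g' : E} (hx : x ∈ lzL R G) (hg : g ∈ G) (hg' : g' ∈ G) (hgg : g * g' = 1) : g * x * g' ∈ lzL R G := by
  obtain ⟨f, hf, hf0, hfG, rfl⟩ := hx
  have hG0 : ∀ g ∈ G, g ∈ R 0 := fun g hg => by
    have := add_mem (hR.anti (Nat.zero_le 1) (hG1 g hg)) hR.one
    simpa using this
  refine ⟨C g * f * C g', by
    simpa using ((LzP.C 0 (hG0 g hg)).mul hR hf).mul hR (LzP.C 0 (hG0 g' hg')), ?_, fun t => ?_, ?_⟩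
  · simp [mul_coeff_zero, hf0, hgg]
  · rw [map_mul, map_mul, lzEv_apply t (C g), lzEv_apply t (C g'), eval_C, eval_C]
    exact mul_mem (mul_mem hg (hfG t)) hg'
  · rw [coeff_mul_C, coeff_C_mul]

theorem lzL_comm (hR : LzFilt R N) (G : Submonoid E) (q : ℕ) (hq : 0 < q) (hG1 : ∀ g ∈ G, g - 1 ∈ R 1)
    (hGq : ∀ g ∈ G, g ^ q = 1) (hqK : (q : K) = 0)
    (hinv : ∀ t : ℕ, 1 ≤ t → t ≤ N → ∃ s : ℕ, (s : K) * (t : K) = 1)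
    {x y : E} (hx : x ∈ lzL R G) (hy : y ∈ lzL R G) : x * y - y * x ∈ lzL R G := by
  have hqE : (q : E) = 0 := by rw [← map_natCast (algebraMap K E), hqK, map_zero]
  have hy1 := lzL_R hy
  obtain ⟨f, hf, hf0, hfG, rfl⟩ := hx
  set m : E[X] := f * C y * f ^ (q - 1) with hm
  have hmP : LzP R 0 m := by
    have := (hf.mul hR (LzP.C 1 hy1)).mul hR (hf.pow hR (q - 1))
    exact this.mono hR (Nat.zero_le _)
  have hm0 : m.coeff 0 = y := by
    simp [hm, mul_coeff_zero, hf0, (lz_coeff1_pow f hf0 (q-1)).1]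
  have hm1 : m.coeff 1 = f.coeff 1 * y - y * f.coeff 1 := by
    rw [hm, mul_coeff_one, (lz_coeff1_pow f hf0 (q-1)).1, (lz_coeff1_pow f hf0 (q-1)).2, coeff_mul_C,
      coeff_mul_C, hf0, Nat.cast_sub hq, hqE, Nat.cast_one]
    noncomm_ring
  have hmL : ∀ t : ℕ, lzEv t m ∈ lzL R G := by
    intro t
    have e : lzEv t m = lzEv t f * y * (lzEv t f) ^ (q - 1) := by
      rw [hm, map_mul, map_mul, map_pow, lzEv_apply t (C y), eval_C]
    rw [e]
    refine lzL_conj hR G hG1 hy (hfG t) (pow_mem (hfG t) _) ?_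
    rw [← pow_succ', Nat.sub_add_cancel hq, hGq _ (hfG t)]
  let M : AddSubgroup E :=
    { carrier := lzL R G
      zero_mem' := lzL_zero hR G
      add_mem' := fun ha hb => lzL_add hR G ha hb
      neg_mem' := fun ha => lzL_neg hR G q hq hqK ha }
  have hdiv : ∀ t : ℕ, lzEv t m = (t : K) • lzEv t m.divX + y := by
    intro t
    conv_lhs => rw [← divX_mul_X_add m]
    rw [map_add, map_mul, hm0, lzEv_apply t (C y), lzEv_apply t X, eval_C, eval_X, Algebra.smul_def,
      map_natCast, (Nat.commute_cast _ t).eq]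
  have key := LzQ.addmem (k := N) (i := 0) (F := fun t => lzEv (t + 1) m.divX) hR M (by omega)
    ((hmP.divX.mono hR (Nat.zero_le _)).Q hR N).shift (fun t ht => by
      obtain ⟨s, hs⟩ := hinv (t + 1) (by omega) (by omega)
      have h1 : (((t + 1 : ℕ) : K)) • lzEv (t + 1) m.divX ∈ lzL R G := by
        have h := M.sub_mem (hmL (t+1)) hy
        rw [hdiv, add_sub_cancel_right] at h
        exact h
      have h2 := lzL_nsmul (K := K) hR G h1 s
      rw [smul_smul, hs, one_smul] at h2
      exact h2) (q - 1)
  simp only [Nat.sub_add_cancel hq, lzEv_apply, hqE, ← coeff_zero_eq_eval_zero, coeff_divX, zero_add,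
    hm1] at key
  exact key

/-- falling factorial polynomials -/
noncomputable def lzD (E : Type*) [Ring E] : ℕ → E[X]
  | 0 => 1
  | k + 1 => lzD E k * (X - C (k : E))

theorem lzD_ev (k t : ℕ) : lzEv t (lzD E k) = ((t.descFactorial k : ℕ) : E) := by
  rw [← descPochhammer_eval_eq_descFactorial]
  induction k with
  | zero => simp [lzD]
  | succ k ih =>
    rw [lzD, map_mul, ih, descPochhammer_succ_eval, map_sub, lzEv_apply t X, lzEv_apply t (C _), eval_C, eval_X]

theorem lzD_P (hR : LzFilt R N) (k : ℕ) : ∀ (i : ℕ) (y : E), y ∈ R (k + i) → LzP R i (C y * lzD E k) := by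
  induction k with
  | zero => intro i y hy; simp only [lzD, mul_one]; exact LzP.C i (by simpa using hy)
  | succ k ih =>
    intro i y hy
    have h := ih (i + 1) y (by convert hy using 2; ring)
    have hk : LzP R 0 (C (-(k : E))) := LzP.C 0 (by
      have := (R 0).smul_mem (-(k : K)) hR.one
      rw [Algebra.smul_def, mul_one, map_neg, map_natCast] at this
      exact this)
    have := (h.mulX).add ((h.mul hR hk).mono hR (Nat.le_succ i))
    convert this using 1
    rw [lzD, C_neg]; noncomm_ring

theorem lz_log (hR : LzFilt R N) (hN : 2 ≤ N) (G : Submonoid E) (hG1 : ∀ g ∈ G, g - 1 ∈ R 1)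
    (hinv : ∀ t : ℕ, 1 ≤ t → t ≤ N → ∃ s : ℕ, (s : K) * (t : K) = 1)
    {g : E} (hg : g ∈ G) : ∃ b : ℕ → K,
      (g - 1) + ∑ k ∈ Finset.range (N - 2), b k • (g - 1) ^ (k + 2) ∈ lzL R G := by
  set c : ℕ → K := fun k => Ring.inverse ((k.factorial : ℕ) : K) with hc
  have hDint : ∀ k : ℕ, ∃ a0 a1 : ℤ, (lzD E k).coeff 0 = a0 ∧ (lzD E k).coeff 1 = a1 := by
    intro k
    induction k with
    | zero => exact ⟨1, 0, by simp [lzD], by simp [lzD, coeff_one]⟩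
    | succ k ih =>
      obtain ⟨a0, a1, h0, h1⟩ := ih
      refine ⟨-a0 * k, a0 - a1 * k, ?_, ?_⟩
      · rw [lzD, mul_coeff_zero, h0]; simp
      · rw [lzD, mul_coeff_one, h0, h1]; simp [sub_eq_add_neg]
  choose a0 a1 ha0 ha1 using hDint
  have hy : ∀ k, c k • (g - 1) ^ k ∈ R (k + 0) := fun k =>
    (R _).smul_mem _ (by simpa using hR.pow_mem (hG1 g hg) k)
  have hnil : ∀ k, N ≤ k → (g - 1) ^ k = 0 := fun k hk => by
      have := hR.pow_mem (hG1 g hg) k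
      exact hR.zero _ (hR.anti (by omega) this)
  refine ⟨fun k => c (k + 2) * (a1 (k + 2) : K), ∑ k ∈ Finset.range N, C (c k • (g - 1) ^ k) * lzD E k,
    ?_, ?_, ?_, ?_⟩
  · have : ∀ n, LzP R 0 (∑ k ∈ Finset.range n, C (c k • (g - 1) ^ k) * lzD E k) := by
      intro n
      induction n with
      | zero => intro k; simp
      | succ n ih => rw [Finset.sum_range_succ]; exact ih.add (lzD_P hR n 0 _ (hy n))
    exact this N
  · rw [finsetSum_coeff]
    obtain ⟨N, rfl⟩ : ∃ M, N = M + 1 := ⟨N - 1, by omega⟩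
    rw [Finset.sum_range_succ', Finset.sum_eq_zero, zero_add]
    · simp [lzD, hc]
    · intro k _
      have : (lzD E (k+1)).coeff 0 = 0 := by
        have := lzD_ev (E := E) (k+1) 0
        rw [Nat.zero_descFactorial_succ, lzEv_apply, Nat.cast_zero, ← coeff_zero_eq_eval_zero] at this
        simpa using this
      rw [coeff_C_mul, this, mul_zero]
  · intro t
    have : lzEv t (∑ k ∈ Finset.range N, C (c k • (g - 1) ^ k) * lzD E k) = g ^ t := by
      rw [map_sum]
      conv_rhs => rw [← sub_add_cancel g 1, (Commute.one_right _).add_pow]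
      have e1 : ∑ k ∈ Finset.range (t + 1), (g - 1) ^ k * 1 ^ (t - k) * ((t.choose k : ℕ) : E)
          = ∑ k ∈ Finset.range (t + 1 + N), (g - 1) ^ k * 1 ^ (t - k) * ((t.choose k : ℕ) : E) := by
        refine Finset.sum_subset (Finset.range_mono (by omega)) fun k _ hk => ?_
        rw [Nat.choose_eq_zero_of_lt (by simpa using hk)]; simp
      have e2 : ∑ k ∈ Finset.range N, (g - 1) ^ k * 1 ^ (t - k) * ((t.choose k : ℕ) : E)
          = ∑ k ∈ Finset.range (t + 1 + N), (g - 1) ^ k * 1 ^ (t - k) * ((t.choose k : ℕ) : E) := by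
        refine Finset.sum_subset (Finset.range_mono (by omega)) fun k _ hk => ?_
        rw [hnil k (by simpa using hk)]; simp
      rw [e1, ← e2]
      refine Finset.sum_congr rfl fun k hk => ?_
      rw [map_mul, lzD_ev, lzEv_apply t (C _), eval_C, Nat.descFactorial_eq_factorial_mul_choose, one_pow, mul_one]
      push_cast
      rw [← mul_assoc]
      congr 1
      have := Ring.inverse_mul_cancel _ (lz_unit_fac hinv k (by have := Finset.mem_range.1 hk; omega))
      rw [(Nat.commute_cast _ _).eq, ← map_natCast (algebraMap K E), ← Algebra.smul_def, smul_smul,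
        mul_comm, this, one_smul]
    rw [this]; exact pow_mem hg t
  · rw [finsetSum_coeff]
    obtain ⟨N, rfl⟩ : ∃ M, N = M + 2 := ⟨N - 2, by omega⟩
    rw [Finset.sum_range_succ', Finset.sum_range_succ', add_tsub_cancel_right]
    have e0 : (C (c 0 • (g - 1) ^ 0) * lzD E 0).coeff 1 = 0 := by
      rw [coeff_C_mul, lzD, coeff_one]; simp
    have e1 : (C (c (0 + 1) • (g - 1) ^ (0 + 1)) * lzD E (0 + 1)).coeff 1 = g - 1 := by
      rw [coeff_C_mul, lzD, lzD]; simp [hc]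
    rw [e0, e1, add_zero, add_comm]
    congr 1
    refine Finset.sum_congr rfl fun k _ => ?_
    rw [coeff_C_mul, ha1, mul_smul, smul_mul_assoc]
    congr 1
    rw [Algebra.smul_def, map_intCast, (Int.commute_cast _ _).eq]

end LazardAbs
section LazardAff

variable {K A : Type*} [CommRing K] [AddCommGroup A] [Module K A]

/-- affine filtration -/
def lzV (Z : ℕ → Submodule K A) : ℕ → Submodule K (A × K)
  | 0 => ⊤
  | i + 1 => (Z i).prod ⊥

/-- operators shifting the filtration -/
def lzR (Z : ℕ → Submodule K A) (k : ℕ) : Submodule K (Module.End K (A × K)) where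
  carrier := {f | ∀ i, ∀ v ∈ lzV Z i, f v ∈ lzV Z (i + k)}
  zero_mem' := by intro i v _; simp
  add_mem' := by intro f g hf hg i v hv; exact add_mem (hf i v hv) (hg i v hv)
  smul_mem' := by intro c f hf i v hv; exact Submodule.smul_mem _ c (hf i v hv)

theorem lzV_anti {Z : ℕ → Submodule K A} (hZ : Antitone Z) : Antitone (lzV Z) := by
  refine antitone_nat_of_succ_le fun i => ?_
  cases i with
  | zero => exact le_top
  | succ i => exact Submodule.prod_mono (hZ (Nat.le_succ i)) le_rfl

theorem lzR_filt {Z : ℕ → Submodule K A} (hZ : Antitone Z) {n : ℕ} (hn : Z n = ⊥) :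
    LzFilt (lzR Z) (n + 1) where
  anti := fun i j hij f hf l v hv => lzV_anti hZ (by omega) (hf l v hv)
  mul := by
    intro i j x y hx hy l v hv
    have := hx _ _ (hy l v hv)
    rw [add_assoc, add_comm j i] at this
    exact this
  one := by intro i v hv; exact hv
  zero := by
    intro x hx
    ext1 <;> ext1
    all_goals
      have h0 := fun v => hx 0 v trivial
      rw [zero_add] at h0
      simp only [lzV, hn, Submodule.prod_bot, Submodule.mem_bot] at h0
      simp [h0]

/-- the affine map attached to `a` -/
def lzg (La : A → A →ₗ[K] A) (a : A) : Module.End K (A × K) where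
  toFun v := (v.1 + La a v.1 + v.2 • a, v.2)
  map_add' v w := by
    ext <;> simp [add_smul]
    abel
  map_smul' c v := by
    ext <;> simp [mul_smul]

theorem lz_prelie (q n : ℕ) (hn1 : 1 ≤ n) (hq : 0 < q) (hqK : (q : K) = 0)
    (hinv : ∀ t : ℕ, 1 ≤ t → t ≤ n + 1 → ∃ s : ℕ, (s : K) * (t : K) = 1)
    (Z : ℕ → Submodule K A) (hZ : Antitone Z) (hZ0 : Z 0 = ⊤) (hZn : Z n = ⊥)
    (La : A → A →ₗ[K] A) (hLZ : ∀ a i, ∀ v ∈ Z i, La a v ∈ Z (i + 1))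
    (hL0 : La 0 = 0)
    (hLmul : ∀ a b, ∃ c, lzg La a * lzg La b = lzg La c)
    (hLq : ∀ a, lzg La a ^ q = 1) :
    ∃ Xm : A →+ Module.End K (A × K), (∀ x, Xm x ∈ lzR Z 1) ∧ (∀ x, Xm x (0, 1) = (x, 0)) ∧
      (∀ x y, Xm x * Xm y - Xm y * Xm x = Xm ((Xm x (y, 0)).1 - (Xm y (x, 0)).1)) ∧
      ∀ x, ∃ a, lzExp K (n + 1) (Xm x) = lzg La a := by
  have hR := lzR_filt hZ hZn
  have hg0 : lzg La 0 = 1 := by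
    refine LinearMap.ext fun v => ?_
    simp [lzg, hL0]
  let G : Submonoid (Module.End K (A × K)) :=
    { carrier := Set.range (lzg La)
      one_mem' := ⟨0, hg0⟩
      mul_mem' := by
        rintro _ _ ⟨a, rfl⟩ ⟨b, rfl⟩
        obtain ⟨c, hc⟩ := hLmul a b
        exact ⟨c, hc.symm⟩ }
  have hG1 : ∀ g ∈ G, g - 1 ∈ lzR Z 1 := by
    rintro _ ⟨a, rfl⟩ i v hv
    have e : (lzg La a - 1) v = (La a v.1 + v.2 • a, 0) := by
      ext
      · simp [lzg, add_assoc]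
      · simp [lzg]
    rw [e]
    cases i with
    | zero => simp [lzV, hZ0]
    | succ i =>
      obtain ⟨h1, h2⟩ := hv
      have h2' : v.2 = 0 := h2
      rw [h2', zero_smul, add_zero]
      exact ⟨hLZ a i _ h1, rfl⟩
  have hGq : ∀ g ∈ G, g ^ q = 1 := by rintro _ ⟨a, rfl⟩; exact hLq a
  set L := lzL (lzR Z) G with hL
  have hexp : ∀ x ∈ L, lzExp K (n + 1) x ∈ G := by
    rintro x ⟨f, hf, hf0, hfG, rfl⟩
    exact lz_key hR G q hq hG1 hGq hqK hinv f hf hf0 hfG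
  have hLsnd : ∀ x ∈ L, ∀ v, (x v).2 = 0 := by
    intro x hx v
    exact (lzL_R hx 0 v trivial).2
  have hexp1 : ∀ x : Module.End K (A × K), lzExp K (n + 1) x = 1 + x * (1 + x *
      ∑ k ∈ Finset.range (n - 1), Ring.inverse (((k + 2).factorial : ℕ) : K) • x ^ k) := by
    intro x
    obtain ⟨n, rfl⟩ : ∃ m, n = m + 1 := ⟨n - 1, by omega⟩
    rw [lzExp, Finset.sum_range_succ', Finset.sum_range_succ', Nat.add_sub_cancel, mul_add, ← mul_assoc,
      Finset.mul_sum]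
    simp only [mul_smul_comm, zero_add, Nat.factorial, Nat.cast_one, Ring.inverse_one, one_smul, pow_zero,
      mul_one, pow_succ]
    rw [add_comm, add_comm x]
    congr 2
    refine Finset.sum_congr rfl fun k _ => ?_
    rw [← pow_succ, ← pow_succ, ← pow_two, ← pow_add]
    congr 2
    omega
  have hinj : ∀ x ∈ L, x (0, 1) = 0 → x = 0 := by
    intro x hx hx0
    obtain ⟨a, ha⟩ := hexp x hx
    have hcomm : Commute x (1 + x *
      ∑ k ∈ Finset.range (n - 1), Ring.inverse (((k + 2).factorial : ℕ) : K) • x ^ k) := by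
      refine (Commute.one_right _).add_right ((Commute.refl _).mul_right ?_)
      exact Commute.sum_right _ _ _ fun k _ => ((Commute.refl x).pow_right k).smul_right _
    have ha0 : a = 0 := by
      have h1 : lzg La a (0, 1) = (a, 1) := by simp [lzg]
      rw [ha, hexp1, hcomm.eq] at h1
      simp [hx0] at h1
      exact h1.symm
    rw [ha0, hg0, hexp1] at ha
    have hz : x * (1 + x *
      ∑ k ∈ Finset.range (n - 1), Ring.inverse (((k + 2).factorial : ℕ) : K) • x ^ k) = 0 := by
      have := ha.symm
      simpa using this
    have hstep : ∀ i, x ∈ lzR Z i := by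
      intro i
      induction i with
      | zero => exact hR.anti (Nat.zero_le 1) (lzL_R hx)
      | succ i ih =>
        have hs : ∑ k ∈ Finset.range (n - 1), Ring.inverse (((k + 2).factorial : ℕ) : K) • x ^ k
            ∈ lzR Z 0 := by
          refine Submodule.sum_mem _ fun k _ => Submodule.smul_mem _ _ ?_
          have := hR.pow_mem (lzL_R hx) k
          exact hR.anti (Nat.zero_le _) this
        have h2 := hR.mul (hR.mul ih (lzL_R hx)) hs
        have e : x = - (x * x * ∑ k ∈ Finset.range (n - 1), Ring.inverse (((k + 2).factorial : ℕ) : K) • x ^ k) := by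
          rw [mul_add, mul_one, ← mul_assoc] at hz
          exact eq_neg_of_add_eq_zero_left hz
        rw [e]
        exact neg_mem h2
    exact hR.zero _ (hstep _)
  have hadd : ∀ {x y}, x ∈ L → y ∈ L → x + y ∈ L := fun hx hy => lzL_add hR G hx hy
  have hneg : ∀ {x}, x ∈ L → -x ∈ L := fun hx => lzL_neg hR G q hq hqK hx
  have hsurj : ∀ d i, i + d = n → ∀ a ∈ Z i, ∃ x ∈ L, x (0, 1) = (a, 0) := by
    intro d
    induction d with
    | zero =>
      intro i hi a ha
      rw [add_zero] at hi
      rw [hi, hZn, Submodule.mem_bot] at ha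
      refine ⟨0, lzL_zero hR G, ?_⟩
      rw [ha]; rfl
    | succ d ih =>
      intro i hi a ha
      obtain ⟨b, hb⟩ := lz_log hR (by omega) G hG1 hinv (g := lzg La a) ⟨a, rfl⟩
      set y := lzg La a - 1 with hy
      have hy1 : y ∈ lzR Z 1 := hG1 _ ⟨a, rfl⟩
      have hya : y (0, 1) = (a, 0) := by
        rw [hy]; ext <;> simp [lzg]
      have hmem : (∑ k ∈ Finset.range (n + 1 - 2), b k • y ^ (k + 2)) (0, 1) ∈ lzV Z (i + 2) := by
        rw [LinearMap.sum_apply]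
        refine Submodule.sum_mem _ fun k _ => ?_
        rw [LinearMap.smul_apply]
        refine Submodule.smul_mem _ _ ?_
        rw [pow_succ, Module.End.mul_apply, hya]
        have := hR.pow_mem hy1 (k + 1) (i + 1) (a, 0) ⟨ha, rfl⟩
        exact lzV_anti hZ (by omega) this
      obtain ⟨hm1, hm2⟩ := hmem
      obtain ⟨x', hx', hx'a⟩ := ih (i + 1) (by omega) _ hm1
      refine ⟨_, hadd hb (hneg hx'), ?_⟩
      have hm2' : ((∑ k ∈ Finset.range (n + 1 - 2), b k • y ^ (k + 2)) (0, 1)).2 = 0 := hm2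
      rw [LinearMap.add_apply, LinearMap.add_apply, LinearMap.neg_apply, hx'a, hya]
      ext
      · simp
      · simp only [Prod.snd_add, hm2', Prod.snd_neg]; simp
  have hex : ∀ a, ∃ x ∈ L, x (0, 1) = (a, 0) := fun a => hsurj n 0 (by omega) a (by rw [hZ0]; trivial)
  choose X hX hXa using hex
  have huniq : ∀ a, ∀ x ∈ L, x (0, 1) = (a, 0) → x = X a := by
    intro a x hx hxa
    have := hinj (x + -X a) (hadd hx (hneg (hX a))) (by
      rw [LinearMap.add_apply, LinearMap.neg_apply, hxa, hXa, add_neg_cancel])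
    rwa [← sub_eq_add_neg, sub_eq_zero] at this
  refine ⟨AddMonoidHom.mk' X fun a b => ?_, fun x => lzL_R (hX x), hXa, fun x y => ?_, fun x => ?_⟩
  · refine (huniq _ _ (hadd (hX a) (hX b)) ?_).symm
    rw [LinearMap.add_apply, hXa, hXa]; simp
  · refine huniq _ _ (lzL_comm hR G q hq hG1 hGq hqK hinv (hX x) (hX y)) ?_
    simp only [AddMonoidHom.mk'_apply]
    rw [LinearMap.sub_apply, Module.End.mul_apply, Module.End.mul_apply, hXa, hXa]
    ext
    · simp
    · simp [hLsnd _ (hX _)]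
  · obtain ⟨a, ha⟩ := hexp _ (hX x)
    exact ⟨a, ha.symm⟩

end LazardAff
section LazardPoly

variable {K : Type*} [CommRing K]

/-- polynomial functions in `t * P` of order at least `m` -/
def lzS (P : K) (M : Type*) [AddCommGroup M] [Module K M] (m : ℕ) : Submodule K (ℕ → M) :=
  Submodule.span K {ψ | ∃ k ≥ m, ∃ v : M, ψ = fun t : ℕ => ((t : K) * P) ^ k • v}

variable {P : K} {M M' M'' : Type*} [AddCommGroup M] [Module K M] [AddCommGroup M'] [Module K M']
  [AddCommGroup M''] [Module K M'']

theorem lzS_gen (m k : ℕ) (hk : m ≤ k) (v : M) :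
    (fun t : ℕ => ((t : K) * P) ^ k • v) ∈ lzS P M m :=
  Submodule.subset_span ⟨k, hk, v, rfl⟩

theorem lzS_anti {m l : ℕ} (h : m ≤ l) : lzS P M l ≤ lzS P M m := by
  refine Submodule.span_mono ?_
  rintro _ ⟨k, hk, v, rfl⟩
  exact ⟨k, h.trans hk, v, rfl⟩

theorem lzS_map (f : M →ₗ[K] M') {m : ℕ} {ψ : ℕ → M} (h : ψ ∈ lzS P M m) :
    (fun t => f (ψ t)) ∈ lzS P M' m := by
  induction h using Submodule.span_induction with
  | mem ψ hψ =>
    obtain ⟨k, hk, v, rfl⟩ := hψ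
    simp only [map_smul]
    exact lzS_gen m k hk _
  | zero => simp only [Pi.zero_apply, map_zero]; exact zero_mem _
  | add x y _ _ hx hy => simp only [Pi.add_apply, map_add]; exact add_mem hx hy
  | smul c x _ hx => simp only [Pi.smul_apply, map_smul]; exact Submodule.smul_mem _ c hx

theorem lzS_bil (f : M →ₗ[K] M' →ₗ[K] M'') {m l : ℕ} {ψ : ℕ → M} {φ : ℕ → M'} (h : ψ ∈ lzS P M m)
    (h' : φ ∈ lzS P M' l) : (fun t => f (ψ t) (φ t)) ∈ lzS P M'' (m + l) := by
  induction h using Submodule.span_induction with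
  | mem ψ hψ =>
    obtain ⟨k, hk, v, rfl⟩ := hψ
    induction h' using Submodule.span_induction with
    | mem φ hφ =>
      obtain ⟨k', hk', v', rfl⟩ := hφ
      simp only [map_smul, LinearMap.smul_apply, smul_smul, ← pow_add]
      exact lzS_gen _ _ (by omega) _
    | zero => simp only [Pi.zero_apply, map_zero]; exact zero_mem _
    | add x y _ _ hx hy => simp only [Pi.add_apply, map_add]; exact add_mem hx hy
    | smul c x _ hx =>
      have := Submodule.smul_mem _ c hx
      convert this using 1
      funext t
      rw [Pi.smul_apply, Pi.smul_apply, map_smul]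
  | zero => simp only [Pi.zero_apply, map_zero, LinearMap.zero_apply]; exact zero_mem _
  | add x y _ _ hx hy => simp only [Pi.add_apply, map_add, LinearMap.add_apply]; exact add_mem hx hy
  | smul c x _ hx =>
    simp only [Pi.smul_apply, map_smul, LinearMap.smul_apply]; exact Submodule.smul_mem _ c hx

theorem lzS_zero {n : ℕ} (hP : P ^ n = 0) {m : ℕ} (hm : n ≤ m) {ψ : ℕ → M} (h : ψ ∈ lzS P M m) :
    ψ = 0 := by
  induction h using Submodule.span_induction with
  | mem ψ hψ =>
    obtain ⟨k, hk, v, rfl⟩ := hψ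
    funext t
    rw [mul_pow, pow_eq_zero_of_le (hm.trans hk) hP]; simp
  | zero => rfl
  | add x y _ _ hx hy => rw [hx, hy, add_zero]
  | smul c x _ hx => rw [hx, smul_zero]

variable {A : Type*} [AddCommGroup A] [Module K A]

theorem lzS_mul {m l : ℕ} {ψ φ : ℕ → Module.End K M} (h : ψ ∈ lzS P _ m) (h' : φ ∈ lzS P _ l) :
    (fun t => ψ t * φ t) ∈ lzS P (Module.End K M) (m + l) :=
  lzS_bil (LinearMap.mul K (Module.End K M)) h h'

theorem lzS_pow {ψ : ℕ → Module.End K M} (h : ψ ∈ lzS P _ 1) (k : ℕ) :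
    (fun t => ψ t ^ k) ∈ lzS P (Module.End K M) k := by
  induction k with
  | zero =>
    simp only [pow_zero]
    simpa using lzS_gen (P := P) 0 0 le_rfl (1 : Module.End K M)
  | succ k ih =>
    simp only [pow_succ]
    exact lzS_mul ih h

theorem lzS_powsub {ψ φ : ℕ → Module.End K M} (h : ψ ∈ lzS P _ 1) (h' : φ ∈ lzS P _ 1) {j : ℕ}
    (hd : ψ - φ ∈ lzS P _ j) (k : ℕ) :
    (fun t => ψ t ^ (k + 1) - φ t ^ (k + 1)) ∈ lzS P (Module.End K M) (j + k) := by
  induction k with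
  | zero =>
    simp only [zero_add, pow_one, add_zero]
    exact hd
  | succ k ih =>
    have h1 := lzS_mul h ih
    have h2 := lzS_mul hd (lzS_pow h' (k + 1))
    rw [show 1 + (j + k) = j + (k + 1) by ring] at h1
    convert add_mem h1 h2 using 1
    funext t
    simp only [Pi.add_apply, Pi.sub_apply]
    rw [pow_succ' _ (k+1), pow_succ' _ (k+1)]
    noncomm_ring

/-- higher terms of the exponential -/
noncomputable def lzTail (n : ℕ) (x : Module.End K M) : Module.End K M :=
  ∑ k ∈ Finset.range (n - 1), Ring.inverse (((k + 2).factorial : ℕ) : K) • x ^ (k + 2)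

theorem lzExp_tail (n : ℕ) (hn1 : 1 ≤ n) (x : Module.End K M) :
    lzExp K (n + 1) x = 1 + x + lzTail n x := by
  obtain ⟨n, rfl⟩ : ∃ m, n = m + 1 := ⟨n - 1, by omega⟩
  rw [lzExp, Finset.sum_range_succ', Finset.sum_range_succ', lzTail, Nat.add_sub_cancel]
  simp only [zero_add, pow_zero, pow_one, Nat.factorial, Nat.cast_one, Ring.inverse_one, one_smul, mul_one]
  abel

theorem lzTail_mem (n : ℕ) {ψ : ℕ → Module.End K M} (h : ψ ∈ lzS P _ 1) :
    (fun t => lzTail n (ψ t)) ∈ lzS P (Module.End K M) 2 := by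
  have : (fun t => lzTail n (ψ t)) = ∑ k ∈ Finset.range (n - 1),
      Ring.inverse (((k + 2).factorial : ℕ) : K) • (fun t => ψ t ^ (k + 2)) := by
    funext t; simp [lzTail, Finset.sum_apply]
  rw [this]
  exact Submodule.sum_mem _ fun k _ => Submodule.smul_mem _ _ (lzS_anti (by omega) (lzS_pow h (k + 2)))

theorem lzTail_sub (n : ℕ) {ψ φ : ℕ → Module.End K M} (h : ψ ∈ lzS P _ 1) (h' : φ ∈ lzS P _ 1) {j : ℕ}
    (hd : ψ - φ ∈ lzS P _ j) :
    (fun t => lzTail n (ψ t) - lzTail n (φ t)) ∈ lzS P (Module.End K M) (j + 1) := by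
  have : (fun t => lzTail n (ψ t) - lzTail n (φ t)) = ∑ k ∈ Finset.range (n - 1),
      Ring.inverse (((k + 2).factorial : ℕ) : K) • (fun t => ψ t ^ (k + 2) - φ t ^ (k + 2)) := by
    funext t; simp [lzTail, Finset.sum_apply, smul_sub]
  rw [this]
  exact Submodule.sum_mem _ fun k _ => Submodule.smul_mem _ _
    (lzS_anti (by omega) (lzS_powsub h h' hd (k + 1)))

theorem lz_poly (n : ℕ) (hn1 : 1 ≤ n) (hP : P ^ n = 0) (La : A → A →ₗ[K] A)
    (Xm : A →ₗ[K] Module.End K (A × K)) (hX1 : ∀ x, Xm x (0, 1) = (x, 0))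
    (hexp : ∀ x, ∃ a, lzExp K (n + 1) (Xm x) = lzg La a) (a b : A) :
    (fun t : ℕ => La (((t : K) * P) • a) b - ((t : K) * P) • (Xm a (b, 0)).1) ∈ lzS P A 2 := by
  set ev : Module.End K (A × K) →ₗ[K] A :=
    (LinearMap.fst K A K).comp (LinearMap.applyₗ ((0, 1) : A × K)) with hev
  have hev' : ∀ f, ev f = (f (0, 1)).1 := fun f => rfl
  set x0 : ℕ → A := fun t => ((t : K) * P) • a with hx0
  have hx0S : x0 ∈ lzS P A 1 := by
    have := lzS_gen (P := P) 1 1 le_rfl a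
    simpa using this
  set Φ : (ℕ → A) → (ℕ → A) := fun x t => ev (lzTail n (Xm (x t))) with hΦ
  have hΦ2 : ∀ x ∈ lzS P A 1, Φ x ∈ lzS P A 2 := fun x hx => lzS_map ev (lzTail_mem n (lzS_map Xm hx))
  have hΦd : ∀ x ∈ lzS P A 1, ∀ y ∈ lzS P A 1, ∀ j, x - y ∈ lzS P A j → Φ x - Φ y ∈ lzS P A (j + 1) := by
    intro x hx y hy j hxy
    have := lzS_map ev (lzTail_sub n (lzS_map Xm hx) (lzS_map Xm hy) (j := j) (by
      have := lzS_map Xm hxy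
      convert this using 1
      funext t; simp))
    convert this using 1
    funext t; simp [hΦ]
  let s : ℕ → (ℕ → A) := fun j => Nat.rec x0 (fun _ x => x0 - Φ x) j
  have hs0 : s 0 = x0 := rfl
  have hss : ∀ j, s (j + 1) = x0 - Φ (s j) := fun j => rfl
  have hs1 : ∀ j, s j ∈ lzS P A 1 := by
    intro j
    induction j with
    | zero => exact hx0S
    | succ j ih => rw [hss]; exact sub_mem hx0S (lzS_anti (by omega) (hΦ2 _ ih))
  have hsd : ∀ j, s (j + 1) - s j ∈ lzS P A (j + 2) := by
    intro j
    induction j with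
    | zero => rw [hss, hs0, sub_sub_cancel_left]; exact neg_mem (hΦ2 _ hx0S)
    | succ j ih =>
      rw [hss (j + 1), hss j, sub_sub_sub_cancel_left, ← neg_sub]
      refine neg_mem ?_
      have := hΦd _ (hs1 (j + 1)) _ (hs1 j) _ ih
      rw [hss j] at this
      exact this
  have hfix : s (n + 1) = s n := by
    have := lzS_zero hP (by omega) (hsd n)
    exact sub_eq_zero.1 this
  set x := s n with hx
  have hxS : x ∈ lzS P A 1 := hs1 n
  have hxeq : x = x0 - Φ x := by rw [← hss, hfix]
  have hxd : x - x0 ∈ lzS P A 2 := by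
    have : x - x0 = - Φ x := by
      conv_lhs => rw [hxeq]
      simp
    rw [this]; exact neg_mem (hΦ2 _ hxS)
  have hgt : ∀ t, lzExp K (n + 1) (Xm (x t)) = lzg La (x0 t) := by
    intro t
    obtain ⟨a', ha'⟩ := hexp (x t)
    have h1 : ev (lzExp K (n + 1) (Xm (x t))) = x0 t := by
      rw [lzExp_tail n hn1, map_add, map_add, hev' (Xm (x t)), hX1]
      have h2 : ev 1 = 0 := rfl
      rw [h2, zero_add]
      have := congrFun hxeq t
      simp only [Pi.sub_apply, hΦ] at this
      exact eq_sub_iff_add_eq.1 this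
    have h2 : a' = x0 t := by
      rw [← h1, ha', hev']
      simp [lzg]
    rw [ha', h2]
  set evb : Module.End K (A × K) →ₗ[K] A :=
    (LinearMap.fst K A K).comp (LinearMap.applyₗ ((b, 0) : A × K)) with hevb
  have hevb' : ∀ f, evb f = (f (b, 0)).1 := fun f => rfl
  have hmem1 := lzS_map evb (lzTail_mem n (lzS_map Xm hxS))
  have hmem2 := lzS_map (evb.comp Xm) hxd
  convert add_mem hmem1 hmem2 using 1
  funext t
  have h1 := congrArg evb (hgt t)
  rw [lzExp_tail n hn1, map_add, map_add] at h1
  have h2 : evb (lzg La (x0 t)) = b + La (x0 t) b := by rw [hevb']; simp [lzg]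
  have h3 : evb 1 = b := rfl
  rw [h2, h3, add_assoc, add_right_inj] at h1
  simp only [Pi.add_apply, Pi.sub_apply, LinearMap.comp_apply, map_sub]
  rw [show La (((t : K) * P) • a) b = La (x0 t) b from rfl, ← h1]
  have h4 : evb (Xm (x0 t)) = ((t : K) * P) • (Xm a (b, 0)).1 := by
    rw [hx0]; simp only [map_smul]; rfl
  rw [h4]; abel

end LazardPoly
section LazardBrace

variable {A : Type u} [AddCommGroup A] (B : LeftBrace A)

theorem lzb_circ (a b : A) : B.circ a b = a + b + B.star a b := by
  rw [LeftBrace.star]; abel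

theorem lzb_star_add (a b c : A) : B.star a (b + c) = B.star a b + B.star a c := by
  have h := B.circ_add a b c
  rw [lzb_circ B a b, lzb_circ B a c, lzb_circ B a (b + c)] at h
  have : B.star a (b + c) + (a + b + c + a) = B.star a b + B.star a c + (a + b + c + a) := by
    rw [show B.star a (b + c) + (a + b + c + a) = a + (b + c) + B.star a (b + c) + a by abel, h]; abel
  exact add_right_cancel this

/-- left star multiplication -/
def lzbL (a : A) : A →+ A := AddMonoidHom.mk' (B.star a) (lzb_star_add B a)

theorem lzb_one : B.one = 0 := by
  have h1 := B.one_circ 0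
  rw [lzb_circ, show B.star B.one 0 = 0 from map_zero (lzbL B B.one)] at h1
  simpa using h1

theorem lzb_star_zero (v : A) : B.star 0 v = 0 := by
  have h1 := B.one_circ v
  rw [lzb_circ, lzb_one] at h1
  simpa using h1

theorem lzb_star_circ (a b v : A) :
    B.star (B.circ a b) v = B.star a v + B.star b v + B.star a (B.star b v) := by
  have h := B.circ_assoc a b v
  rw [lzb_circ B (B.circ a b) v, lzb_circ B b v, lzb_circ B a (b + v + B.star b v), lzb_star_add, lzb_star_add,
    lzb_circ B a b] at h
  rw [lzb_circ B a b]
  have : B.star (a + b + B.star a b) v + (a + b + B.star a b + v) =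
    B.star a v + B.star b v + B.star a (B.star b v) + (a + b + B.star a b + v) := by
    rw [add_comm, h]; abel
  exact add_right_cancel this

/-- the circle group -/
abbrev lzbGroup : Group A :=
  letI : Mul A := ⟨B.circ⟩
  letI : One A := ⟨B.one⟩
  letI : Inv A := ⟨B.inv⟩
  Group.ofLeftAxioms B.circ_assoc B.one_circ B.inv_circ

theorem lzb_fixed (p n : ℕ) (hp : p.Prime) (hcard : Nat.card A = p ^ n) (W : AddSubgroup A)
    (hW : ∀ a, ∀ v ∈ W, B.star a v ∈ W) (hWt : W ≠ ⊤) : ∃ v, v ∉ W ∧ ∀ a, B.star a v ∈ W := by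
  letI := lzbGroup B
  haveI : Finite A := Nat.finite_of_card_ne_zero (by rw [hcard]; exact pow_ne_zero _ hp.ne_zero)
  haveI : Fact p.Prime := ⟨hp⟩
  have hG : IsPGroup p A := IsPGroup.of_card hcard
  let lam : A → (A →+ A) := fun a => AddMonoidHom.id A + lzbL B a
  have hlam : ∀ a v, lam a v = v + B.star a v := fun a v => rfl
  letI act : MulAction A (A ⧸ W) :=
    { smul := fun a => QuotientAddGroup.map W W (lam a) (fun v hv => by
        show lam a v ∈ W
        rw [hlam]; exact add_mem hv (hW a v hv))
      one_smul := by
        intro b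
        induction b using QuotientAddGroup.induction_on with
        | H v =>
          show ((lam B.one v : A) : A ⧸ W) = v
          rw [hlam, lzb_one, lzb_star_zero, add_zero]
      mul_smul := by
        intro a b c
        induction c using QuotientAddGroup.induction_on with
        | H v =>
          show ((lam (B.circ a b) v : A) : A ⧸ W) = ((lam a (lam b v) : A) : A ⧸ W)
          rw [hlam, hlam, hlam, lzb_star_circ, lzb_star_add]
          congr 1; abel }
  have hsm : ∀ a v : A, a • (v : A ⧸ W) = ((v + B.star a v : A) : A ⧸ W) := fun a v => rfl
  have hdvd : p ∣ Nat.card (A ⧸ W) := by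
    have h1 : Nat.card (A ⧸ W) ∣ p ^ n := by
      rw [← hcard, W.card_eq_card_quotient_mul_card_addSubgroup]; exact dvd_mul_right _ _
    obtain ⟨k, hk, hk'⟩ := (Nat.dvd_prime_pow hp).1 h1
    rw [hk']
    refine dvd_pow_self p ?_
    rintro rfl
    apply hWt
    rw [pow_zero] at hk'
    exact AddSubgroup.index_eq_one.1 hk'
  obtain ⟨b, hb, hb0⟩ := hG.exists_fixed_point_of_prime_dvd_card_of_fixed_point (A ⧸ W) hdvd
    (a := ((0 : A) : A ⧸ W)) (fun a => by
      rw [hsm, show B.star a 0 = 0 from map_zero (lzbL B a), add_zero])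
  induction b using QuotientAddGroup.induction_on with
  | H v =>
    refine ⟨v, fun hv => hb0 ?_, fun a => ?_⟩
    · rw [QuotientAddGroup.mk_zero]; exact ((QuotientAddGroup.eq_zero_iff v).2 hv).symm
    · have := hb a
      rw [hsm, QuotientAddGroup.mk_add, add_eq_left] at this
      exact (QuotientAddGroup.eq_zero_iff _).1 this

/-- the ascending chain -/
def lzbZ : ℕ → AddSubgroup A
  | 0 => ⊥
  | i + 1 =>
    { carrier := {v | ∀ a, B.star a v ∈ lzbZ i}
      zero_mem' := fun a => by
        rw [show B.star a 0 = 0 from map_zero (lzbL B a)]; exact zero_mem _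
      add_mem' := fun {v w} hv hw a => by rw [lzb_star_add]; exact add_mem (hv a) (hw a)
      neg_mem' := fun {v} hv a => by
        rw [show B.star a (-v) = - B.star a v from map_neg (lzbL B a) v]; exact neg_mem (hv a) }

theorem lzbZ_succ (i : ℕ) : lzbZ B i ≤ lzbZ B (i + 1) := by
  induction i with
  | zero => exact bot_le
  | succ i ih => intro v hv a; exact ih (hv a)

theorem lzbZ_mono : Monotone (lzbZ B) := monotone_nat_of_le_succ (lzbZ_succ B)

theorem lzbZ_top (p n : ℕ) (hp : p.Prime) (hcard : Nat.card A = p ^ n) : lzbZ B n = ⊤ := by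
  haveI : Finite A := Nat.finite_of_card_ne_zero (by rw [hcard]; exact pow_ne_zero _ hp.ne_zero)
  have h : ∀ i, lzbZ B i = ⊤ ∨ p ^ i ≤ Nat.card (lzbZ B i) := by
    intro i
    induction i with
    | zero => right; simp [lzbZ]
    | succ i ih =>
      by_cases ht : lzbZ B i = ⊤
      · left
        have := lzbZ_succ B i
        rw [ht] at this
        exact top_le_iff.1 this
      right
      have ih := ih.resolve_left ht
      obtain ⟨v, hv, hv'⟩ := lzb_fixed B p n hp hcard (lzbZ B i)
        (fun a v hv => lzbZ_succ B i hv a) ht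
      obtain ⟨j, -, hj⟩ := (Nat.dvd_prime_pow hp).1 (hcard ▸ (lzbZ B i).card_addSubgroup_dvd_card)
      obtain ⟨k, -, hk⟩ := (Nat.dvd_prime_pow hp).1 (hcard ▸ (lzbZ B (i+1)).card_addSubgroup_dvd_card)
      have hlt : Nat.card (lzbZ B i) < Nat.card (lzbZ B (i + 1)) := by
        by_contra hcon
        have := AddSubgroup.eq_of_le_of_card_ge (lzbZ_succ B i) (not_lt.1 hcon)
        exact hv (this ▸ (show v ∈ lzbZ B (i + 1) from hv'))
      rw [hj, hk] at hlt
      rw [hj] at ih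
      rw [hk]
      have h1 := (Nat.pow_le_pow_iff_right hp.one_lt).1 ih
      have h2 := (Nat.pow_lt_pow_iff_right hp.one_lt).1 hlt
      exact Nat.pow_le_pow_right hp.pos (by omega)
  rcases h n with h | h
  · exact h
  · exact AddSubgroup.eq_top_of_le_card _ (by rw [hcard]; exact h)

/-- The pre-Lie product of a brace and its relation with `*`. -/
theorem lzb_main (p n : ℕ) (hp : p.Prime) (hpn : n + 1 < p) (hn1 : 1 ≤ n) (hcard : Nat.card A = p ^ n)
    [Module (ZMod (p ^ n)) A] :
    ∃ T : A →+ A →+ A, (∀ x y z, T (T x y) z - T x (T y z) = T (T y x) z - T y (T x z)) ∧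
      ∀ a b, (fun t : ℕ => B.star (t • p • a) b - t • p • T a b) ∈
        lzS (p : ZMod (p ^ n)) A 2 := by
  haveI : Finite A := Nat.finite_of_card_ne_zero (by rw [hcard]; exact pow_ne_zero _ hp.ne_zero)
  have hq : 0 < p ^ n := pow_pos hp.pos n
  haveI : NeZero (p ^ n) := ⟨hq.ne'⟩
  set K := ZMod (p ^ n) with hK
  have hqK : ((p ^ n : ℕ) : K) = 0 := ZMod.natCast_self _
  have hinv : ∀ t : ℕ, 1 ≤ t → t ≤ n + 1 → ∃ s : ℕ, (s : K) * (t : K) = 1 := by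
    intro t h1 h2
    have hc : Nat.Coprime t (p ^ n) := Nat.Coprime.pow_right n
      ((Nat.Prime.coprime_iff_not_dvd hp).2
        (fun h => absurd (Nat.le_of_dvd (by omega) h) (by omega))).symm
    refine ⟨((t : K)⁻¹).val, ?_⟩
    rw [ZMod.natCast_val, ZMod.cast_id, mul_comm]
    exact ZMod.coe_mul_inv_eq_one t hc
  let La : A → A →ₗ[K] A := fun a => (lzbL B a).toZModLinearMap (p ^ n)
  have hLa : ∀ a v, La a v = B.star a v := fun a v => rfl
  let Z : ℕ → Submodule K A := fun i => AddSubgroup.toZModSubmodule (p ^ n) (lzbZ B (n - i))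
  have hZm : ∀ i v, v ∈ Z i ↔ v ∈ lzbZ B (n - i) := fun i v => Iff.rfl
  have hmul : ∀ a b, lzg La a * lzg La b = lzg La (B.circ a b) := by
    intro a b
    refine LinearMap.ext fun v => ?_
    rw [Module.End.mul_apply]
    simp only [lzg, LinearMap.coe_mk, AddHom.coe_mk, map_add, map_smul]
    simp only [hLa, lzb_star_circ]
    rw [lzb_circ B a b]
    simp only [smul_add, Prod.mk.injEq, and_true]
    abel
  have hg0 : lzg La 0 = 1 := by
    refine LinearMap.ext fun v => ?_
    simp [lzg, hLa, lzb_star_zero]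
  have hpow : ∀ a, lzg La a ^ (p ^ n) = 1 := by
    intro a
    letI := lzbGroup B
    have h : ∀ m : ℕ, lzg La a ^ m = lzg La (a ^ m) := by
      intro m
      induction m with
      | zero =>
        rw [pow_zero, pow_zero, ← hg0]
        congr 1
        exact (lzb_one B).symm
      | succ m ih => rw [pow_succ, pow_succ, ih, hmul]; rfl
    have e : a ^ (p ^ n) = 1 := by rw [← hcard]; exact pow_card_eq_one'
    rw [h, e, ← hg0]
    congr 1
    exact lzb_one B
  obtain ⟨Xm, hX1, hX2, hX3, hX4⟩ := lz_prelie (p ^ n) n hn1 hq hqK hinv Z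
    (fun i j hij v hv => lzbZ_mono B (by omega) hv)
    (by
      refine eq_top_iff.2 fun v _ => ?_
      rw [hZm, Nat.sub_zero, lzbZ_top B p n hp hcard]; trivial)
    (by
      refine eq_bot_iff.2 fun v hv => ?_
      rw [hZm, Nat.sub_self] at hv
      exact hv)
    La
    (by
      intro a i v hv
      rw [hZm] at hv ⊢
      rw [hLa]
      have := lzbZ_succ B _ hv a
      by_cases h : i < n
      · rw [show n - i = n - (i + 1) + 1 by omega] at hv
        exact hv a
      · rw [show n - i = 0 by omega] at hv
        have hv0 : v = 0 := hv
        rw [hv0, show B.star a 0 = 0 from map_zero (lzbL B a)]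
        exact zero_mem _)
    (by refine LinearMap.ext fun v => ?_; rw [hLa, lzb_star_zero]; rfl)
    (fun a b => ⟨_, hmul a b⟩) hpow
  have hX0 : ∀ x v, (Xm x v).2 = 0 := fun x v => (hX1 x 0 v trivial).2
  let T : A →+ A →+ A := AddMonoidHom.mk' (fun x => AddMonoidHom.mk' (fun y => (Xm x (y, 0)).1)
      (fun y z => by
        rw [← Prod.fst_add, ← map_add]; simp))
    (fun x y => by ext z; simp)
  have hT : ∀ x y, T x y = (Xm x (y, 0)).1 := fun x y => rfl
  have hT' : ∀ x y, Xm x (y, 0) = (T x y, 0) := fun x y => Prod.ext rfl (hX0 _ _)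
  refine ⟨T, ?_, ?_⟩
  · intro x y z
    have h := congrArg (fun f => (f (z, 0)).1) (hX3 x y)
    simp only [LinearMap.sub_apply, Module.End.mul_apply, hT', map_sub, Prod.fst_sub] at h
    rw [sub_eq_sub_iff_add_eq_add] at h ⊢
    rw [← h, add_comm]
  · intro a b
    have := lz_poly n hn1 (P := (p : K)) (by rw [← Nat.cast_pow]; exact hqK) La
      (Xm.toZModLinearMap (p ^ n)) hX2 hX4 a b
    convert this using 2 with t
    simp only [mul_smul, Nat.cast_smul_eq_nsmul, hLa]
    rfl

end LazardBrace
section LazardFinal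

theorem lz5_xi (p n γ : ℕ) (hp : p.Prime) (hpn : n + 1 < p) (hn1 : 1 ≤ n)
    (hγ : ∀ u : (ZMod (p ^ p))ˣ, ∃ k : ℕ, (γ : ZMod (p ^ p)) ^ k = (u : ZMod (p ^ p)))
    (ξ : ℕ) (hξ : ξ = γ ^ (p ^ (p - 1))) :
    (ξ : ZMod (p ^ n)) ^ (p - 1) = 1 ∧ ∀ m, 1 ≤ m → m < p - 1 →
      ∑ i ∈ Finset.range (p - 1), ((ξ : ZMod (p ^ n)) ^ m) ^ i = 0 := by
  haveI : Fact p.Prime := ⟨hp⟩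
  have hpp : 2 < p ^ p := lt_of_lt_of_le (by omega) (Nat.le_self_pow hp.ne_zero p)
  haveI : Fact (2 < p ^ p) := ⟨hpp⟩
  haveI : NeZero (p ^ p) := ⟨by omega⟩
  have hu : IsUnit (γ : ZMod (p ^ p)) := by
    obtain ⟨k, hk⟩ := hγ (-1)
    have hk0 : k ≠ 0 := by
      rintro rfl
      rw [pow_zero, Units.val_neg, Units.val_one] at hk
      exact ZMod.neg_one_ne_one hk.symm
    exact (isUnit_pow_iff hk0).1 (hk ▸ Units.isUnit _)
  have h1 : (ξ : ZMod (p ^ p)) ^ (p - 1) = 1 := by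
    obtain ⟨g, hg⟩ := hu
    have := ZMod.pow_totient g
    rw [Nat.totient_prime_pow hp hp.pos] at this
    rw [hξ, Nat.cast_pow, ← pow_mul, ← hg, ← Units.val_pow_eq_pow_val, this, Units.val_one]
  have h2 : (ξ : ZMod (p ^ n)) ^ (p - 1) = 1 := by
    have := congrArg (ZMod.castHom (pow_dvd_pow p (show n ≤ p by omega)) (ZMod (p ^ n))) h1
    rwa [map_pow, map_natCast, map_one] at this
  refine ⟨h2, fun m hm1 hm2 => ?_⟩
  have hdp : p ∣ p ^ p := dvd_pow_self p hp.ne_zero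
  have hup : IsUnit (γ : ZMod p) := by
    have := hu.map (ZMod.castHom hdp (ZMod p))
    rwa [map_natCast] at this
  have h3 : ((ξ : ZMod p)) ^ m ≠ 1 := by
    rw [hξ, Nat.cast_pow, ZMod.pow_card_pow]
    intro hcon
    obtain ⟨g, hg⟩ := hup
    have hgen : ∀ u : (ZMod p)ˣ, u ∈ Subgroup.zpowers g := by
      intro u
      obtain ⟨w, hw⟩ := ZMod.unitsMap_surjective hdp u
      obtain ⟨k, hk⟩ := hγ w
      refine ⟨k, ?_⟩
      ext
      have := congrArg (ZMod.castHom hdp (ZMod p)) hk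
      rw [map_pow, map_natCast] at this
      simp only [zpow_natCast, Units.val_pow_eq_pow_val, hg, this, ← hw]
      rfl
    have hord := orderOf_eq_card_of_forall_mem_zpowers hgen
    rw [Nat.card_eq_fintype_card, ZMod.card_units] at hord
    have hgm : g ^ m = 1 := by ext; simpa [hg] using hcon
    have := Nat.le_of_dvd (by omega) (orderOf_dvd_of_pow_eq_one hgm)
    omega
  have hγ0 : γ ≠ 0 := by
    rintro rfl
    rw [Nat.cast_zero] at hup
    exact not_isUnit_zero hup
  have hξ1 : 1 ≤ ξ ^ m := by rw [hξ]; exact Nat.one_le_iff_ne_zero.2 (pow_ne_zero _ (pow_ne_zero _ hγ0))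
  have hunit : IsUnit ((ξ : ZMod (p ^ n)) ^ m - 1) := by
    have : ((ξ ^ m - 1 : ℕ) : ZMod (p ^ n)) = (ξ : ZMod (p ^ n)) ^ m - 1 := by
      rw [Nat.cast_sub hξ1]; simp
    rw [← this, ZMod.isUnit_iff_coprime]
    refine Nat.Coprime.pow_right n ((Nat.Prime.coprime_iff_not_dvd hp).2 fun h => h3 ?_).symm
    have h4 := (ZMod.natCast_eq_zero_iff _ _).2 h
    rw [Nat.cast_sub hξ1, sub_eq_zero] at h4
    simpa using h4
  have h5 := geom_sum_mul ((ξ : ZMod (p ^ n)) ^ m) (p - 1)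
  rw [← pow_mul, mul_comm m, pow_mul, h2, one_pow, sub_self] at h5
  exact (hunit.mul_left_eq_zero).1 h5

theorem lz5_kill (p n ξ : ℕ) (hpn : n + 1 < p) {A : Type u} [AddCommGroup A]
    [Module (ZMod (p ^ n)) A]
    (h1 : (ξ : ZMod (p ^ n)) ^ (p - 1) = 1)
    (hξ : ∀ m, 1 ≤ m → m < p - 1 → ∑ i ∈ Finset.range (p - 1), ((ξ : ZMod (p ^ n)) ^ m) ^ i = 0)
    (ψ : ℕ → A) (hψ : ψ ∈ lzS (p : ZMod (p ^ n)) A 2) :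
    ∃ c : ℕ → A, (∀ t, ψ t = p • c t) ∧
      ∑ i ∈ Finset.range (p - 1), (ξ ^ (p - 1 - i)) • c (ξ ^ i) = 0 := by
  refine Submodule.span_induction (p := fun ψ _ => ∃ c : ℕ → A, (∀ t, ψ t = p • c t) ∧
      ∑ i ∈ Finset.range (p - 1), (ξ ^ (p - 1 - i)) • c (ξ ^ i) = 0) ?_ ?_ ?_ ?_ hψ
  · rintro _ ⟨k, hk, v, rfl⟩
    refine ⟨fun t => ((t : ZMod (p ^ n)) ^ k * (p : ZMod (p ^ n)) ^ (k - 1)) • v, fun t => ?_, ?_⟩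
    · rw [← Nat.cast_smul_eq_nsmul (ZMod (p ^ n)), smul_smul]
      congr 1
      obtain ⟨k, rfl⟩ : ∃ j, k = j + 1 := ⟨k - 1, by omega⟩
      rw [Nat.add_sub_cancel]; ring
    · by_cases hkn : n ≤ k - 1
      · have : (p : ZMod (p ^ n)) ^ (k - 1) = 0 := by
          have h0 : (p : ZMod (p ^ n)) ^ n = 0 := by rw [← Nat.cast_pow]; exact ZMod.natCast_self _
          rw [← Nat.sub_add_cancel hkn, pow_add, h0, mul_zero]
        simp [this]
      · have h2 := hξ (k - 1) (by omega) (by omega)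
        have : ∀ i ∈ Finset.range (p - 1), (ξ ^ (p - 1 - i)) •
            ((((ξ ^ i : ℕ) : ZMod (p ^ n)) ^ k * (p : ZMod (p ^ n)) ^ (k - 1)) • v) =
            ((ξ : ZMod (p ^ n)) ^ (k - 1)) ^ i • ((p : ZMod (p ^ n)) ^ (k - 1) • v) := by
          intro i hi
          rw [Finset.mem_range] at hi
          rw [← Nat.cast_smul_eq_nsmul (ZMod (p ^ n)), smul_smul, smul_smul, ← mul_assoc]
          congr 2
          push_cast
          obtain ⟨k, rfl⟩ : ∃ j, k = j + 1 := ⟨k - 1, by omega⟩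
          rw [Nat.add_sub_cancel, ← pow_mul, ← pow_mul, mul_add, mul_one, pow_add, mul_comm i k,
            mul_comm (_ ^ (k * i)), ← mul_assoc, ← pow_add, Nat.sub_add_cancel hi.le, h1, one_mul]
        rw [Finset.sum_congr rfl this, ← Finset.sum_smul, h2, zero_smul]
  · exact ⟨0, by simp, by simp⟩
  · rintro f g - - ⟨c, hc, hc'⟩ ⟨d, hd, hd'⟩
    refine ⟨c + d, fun t => by simp [hc, hd], ?_⟩
    simp only [Pi.add_apply, smul_add, Finset.sum_add_distrib, hc', hd', add_zero]
  · rintro a f - ⟨c, hc, hc'⟩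
    refine ⟨a • c, fun t => ?_, ?_⟩
    · rw [Pi.smul_apply, Pi.smul_apply, hc, smul_comm]
    · simp only [Pi.smul_apply]
      rw [Finset.sum_congr rfl (fun i _ => smul_comm _ a _), ← Finset.smul_sum, hc', smul_zero]

end LazardFinal

/-- `(A/ann(p²),+,•)` is a pre-Lie ring: `•` is biadditive and satisfies
the pre-Lie identity. -/
theorem stmt_12 (p n : ℕ) (hp : p.Prime) (hpn : n + 1 < p)
    (A : Type u) [AddCommGroup A] (B : LeftBrace A) (hcard : Nat.card A = p ^ n)
    (γ : ℕ)
    (hγ : ∀ u : (ZMod (p ^ p))ˣ, ∃ k : ℕ, (γ : ZMod (p ^ p)) ^ k = (u : ZMod (p ^ p)))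
    (odot bullet :
      (A ⧸ annSub A (p ^ 2)) → (A ⧸ annSub A (p ^ 2)) → (A ⧸ annSub A (p ^ 2)))
    (hodot : ∀ a b c : A, p • c = B.star (p • a) b →
      odot (qmk (p ^ 2) a) (qmk (p ^ 2) b) = qmk (p ^ 2) c)
    (hbull : ∀ x y : A, bullet (qmk (p ^ 2) x) (qmk (p ^ 2) y) =
      ∑ i ∈ Finset.range (p - 1), (γ ^ (p ^ (p - 1))) ^ (p - 1 - i) •
        odot (qmk (p ^ 2) ((γ ^ (p ^ (p - 1))) ^ i • x)) (qmk (p ^ 2) y)) :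
    (∀ x y z : A ⧸ annSub A (p ^ 2), bullet (x + y) z = bullet x z + bullet y z) ∧
    (∀ x y z : A ⧸ annSub A (p ^ 2), bullet x (y + z) = bullet x y + bullet x z) ∧
    (∀ x y z : A,
      bullet (bullet (qmk (p ^ 2) x) (qmk (p ^ 2) y)) (qmk (p ^ 2) z)
          - bullet (qmk (p ^ 2) x) (bullet (qmk (p ^ 2) y) (qmk (p ^ 2) z))
        = bullet (bullet (qmk (p ^ 2) y) (qmk (p ^ 2) x)) (qmk (p ^ 2) z)
          - bullet (qmk (p ^ 2) y) (bullet (qmk (p ^ 2) x) (qmk (p ^ 2) z))) := by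
  rcases Nat.eq_zero_or_pos n with hn0 | hn1
  · subst hn0
    have : Subsingleton A := (Nat.card_eq_one_iff_unique.1 (by rw [hcard, pow_zero])).1
    have : Subsingleton (A ⧸ annSub A (p ^ 2)) := Quotient.instSubsingletonQuotient _
    exact ⟨fun _ _ _ => Subsingleton.elim _ _, fun _ _ _ => Subsingleton.elim _ _,
      fun _ _ _ => Subsingleton.elim _ _⟩
  haveI : Finite A := Nat.finite_of_card_ne_zero (by rw [hcard]; exact pow_ne_zero _ hp.ne_zero)
  letI : Module (ZMod (p ^ n)) A := AddCommGroup.zmodModule (fun x => by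
    rw [← hcard]; exact card_nsmul_eq_zero')
  obtain ⟨h1, hξ⟩ := lz5_xi p n γ hp hpn hn1 hγ _ rfl
  obtain ⟨T, hT, hTp⟩ := lzb_main B p n hp hpn hn1 hcard
  generalize γ ^ (p ^ (p - 1)) = ξ at *
  let q : A →+ A ⧸ annSub A (p ^ 2) := QuotientAddGroup.mk' _
  have hq : ∀ a, qmk (p ^ 2) a = q a := fun a => rfl
  have key : ∀ x y : A, bullet (q x) (q y) = q ((p - 1) • T x y) := by
    intro x y
    obtain ⟨c, hc, hc0⟩ := lz5_kill p n ξ hpn h1 hξ _ (hTp x y)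
    have ho : ∀ i, odot (q (ξ ^ i • x)) (q y) = q (ξ ^ i • T x y + c (ξ ^ i)) := by
      intro i
      rw [← hq, ← hq, ← hq]
      apply hodot
      have := hc (ξ ^ i)
      rw [sub_eq_iff_eq_add, smul_comm _ p x] at this
      rw [this, smul_add, smul_comm p, add_comm]
    rw [← hq, ← hq, hbull]
    simp only [hq, ho, ← map_nsmul q]
    rw [← map_sum]
    congr 1
    simp only [smul_add, Finset.sum_add_distrib, hc0, add_zero]
    have : ∀ i ∈ Finset.range (p - 1), ξ ^ (p - 1 - i) • ξ ^ i • T x y = T x y := by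
      intro i hi
      rw [Finset.mem_range] at hi
      rw [smul_smul, ← pow_add, Nat.sub_add_cancel hi.le, ← Nat.cast_smul_eq_nsmul (ZMod (p ^ n)),
        Nat.cast_pow, h1, one_smul]
    rw [Finset.sum_congr rfl this, Finset.sum_const, Finset.card_range]
  have hs : ∀ x, ∃ a, q a = x := QuotientAddGroup.mk'_surjective _
  refine ⟨?_, ?_, ?_⟩
  · intro x y z
    obtain ⟨x, rfl⟩ := hs x
    obtain ⟨y, rfl⟩ := hs y
    obtain ⟨z, rfl⟩ := hs z
    rw [← map_add, key, key, key, ← map_add, map_add, AddMonoidHom.add_apply, smul_add]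
  · intro x y z
    obtain ⟨x, rfl⟩ := hs x
    obtain ⟨y, rfl⟩ := hs y
    obtain ⟨z, rfl⟩ := hs z
    rw [← map_add, key, key, key, ← map_add, map_add (T x), smul_add]
  · intro x y z
    simp only [hq, key, map_nsmul T, map_nsmul (T _), AddMonoidHom.nsmul_apply]
    rw [← map_sub, ← map_sub, ← smul_sub, ← smul_sub, ← smul_sub, ← smul_sub, hT x y z]
end
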